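/- arXiv:2408.02328 — 2 statements merged into one kernel-verified Lean document; each statement's English description precedes it below -/
import Mathlib

section
/- There exist constants C > 0 and N_0 such that for all integers N > N_0, every subset S ⊆ {1, 2, ..., N} containing no three-term arithmetic progression satisfies |S| ≤ C · N · √(log log N / log N). -/
namespace Bourgain

open Finset

variable {G : Type*} [AddCommGroup G] [Fintype G] [DecidableEq G]

/-- The real-valued indicator function of a finite set. -/
def ind (B : Finset G) (x : G) : ℝ := if x ∈ B then 1 else 0

/-- Translating `B` by any element of `T` changes it by at most a proportion `ε`. -/
def AlmostInvariant (B T : Finset G) (ε : ℝ) : Prop :=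
  ∀ t ∈ T, ∑ y, |ind B (y + t) - ind B y| ≤ ε * #B

omit [Fintype G] [AddCommGroup G] in
lemma ind_nonneg (B : Finset G) (x : G) : 0 ≤ ind B x := by
  unfold ind; split_ifs <;> norm_num

omit [Fintype G] [AddCommGroup G] in
lemma ind_le_one (B : Finset G) (x : G) : ind B x ≤ 1 := by
  unfold ind; split_ifs <;> norm_num

omit [AddCommGroup G] in
lemma sum_ind_mul (B : Finset G) (f : G → ℝ) : ∑ x, ind B x * f x = ∑ x ∈ B, f x := by
  simp [ind, Finset.sum_ite_mem]

omit [AddCommGroup G] in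
lemma sum_mul_ind (B : Finset G) (f : G → ℝ) : ∑ x, f x * ind B x = ∑ x ∈ B, f x := by
  simp [ind, Finset.sum_ite_mem]

omit [AddCommGroup G] in
lemma sum_ind (B : Finset G) : ∑ x, ind B x = #B := by
  simp [ind, Finset.sum_ite_mem]

lemma AlmostInvariant.abs_sum_le {B T : Finset G} {ε : ℝ} (hB : AlmostInvariant B T ε) {t : G}
    (ht : t ∈ T) {f : G → ℝ} (hf : ∀ x, |f x| ≤ 1) :
    |∑ x ∈ B, f (x + t) - ∑ x ∈ B, f x| ≤ ε * #B := by
  have h1 : ∑ x ∈ B, f x = ∑ x, ind B (x + t) * f (x + t) := by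
    rw [← sum_ind_mul, ← Equiv.sum_comp (Equiv.addRight t)]; rfl
  rw [h1, ← sum_ind_mul, ← Finset.sum_sub_distrib]
  refine (Finset.abs_sum_le_sum_abs _ _).trans (le_trans (Finset.sum_le_sum fun y _ => ?_) (hB t ht))
  rw [← sub_mul, abs_mul, abs_sub_comm]
  exact mul_le_of_le_one_right (abs_nonneg _) (hf _)

lemma le_sum_translates {B T : Finset G} {ε : ℝ} (hB : AlmostInvariant B T ε)
    {f : G → ℝ} (hf : ∀ x, |f x| ≤ 1) :
    #T * (∑ x ∈ B, f x - ε * #B) ≤ ∑ x ∈ B, ∑ t ∈ T, f (x + t) := by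
  rw [Finset.sum_comm, ← nsmul_eq_mul, ← Finset.sum_const]
  refine Finset.sum_le_sum fun t ht => ?_
  have := (abs_le.1 (hB.abs_sum_le ht hf)).1
  linarith

/-- If all averages of `f` over translates of `T` are at most `γ`, then the averages over `T` of
the balanced function of `f` on `B` are small in `L¹`. -/
lemma sum_abs_sum_balanced_le {B T : Finset G} {φ : G → G} {ε β γ : ℝ}
    (hB : AlmostInvariant B (T.image φ) ε)
    {f : G → ℝ} (hf0 : ∀ x, 0 ≤ f x) (hf1 : ∀ x, f x ≤ 1) (hβ : 0 ≤ β) (hβγ : β ≤ γ)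
    (hmean : ∑ y, (f y - β) * ind B y = 0)
    (hγ : ∀ y, ∑ t ∈ T, f (y + φ t) ≤ γ * #T) :
    ∑ y, |∑ t ∈ T, (f (y + φ t) - β) * ind B (y + φ t)| ≤ 2 * (γ - β + ε) * (#B * #T) := by
  set F : G → ℝ := fun y => ∑ t ∈ T, (f (y + φ t) - β) * ind B (y + φ t) with hF
  set D : G → ℝ := fun y => ∑ t ∈ T, |ind B (y + φ t) - ind B y| with hD
  have hDsum : ∑ y, D y ≤ #T * (ε * #B) := by
    simp only [hD]
    rw [Finset.sum_comm, ← nsmul_eq_mul, ← Finset.sum_const]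
    exact Finset.sum_le_sum fun t ht => hB _ (Finset.mem_image_of_mem _ ht)
  have hFsum : ∑ y, F y = 0 := by
    simp only [hF]
    rw [Finset.sum_comm]
    refine Finset.sum_eq_zero fun t _ => ?_
    rw [← hmean]
    exact Equiv.sum_comp (Equiv.addRight (φ t)) (fun y => (f y - β) * ind B y)
  have hFD : ∀ y, F y ≤ (γ - β) * #T * ind B y + D y := by
    intro y
    by_cases hy : y ∈ B
    · have h1 : ind B y = 1 := by simp [ind, hy]
      have h2 : F y ≤ ∑ t ∈ T, (f (y + φ t) - β + |ind B (y + φ t) - ind B y|) := by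
        refine Finset.sum_le_sum fun t _ => ?_
        by_cases ht : y + φ t ∈ B
        · simp [ind, hy, ht]
        · have : ind B (y + φ t) = 0 := by simp [ind, ht]
          rw [this, h1]
          norm_num
          have hβ1 : β ≤ 1 := by
            by_contra hcon
            push Not at hcon
            have h3 : ∑ y, (β - f y) * ind B y ≤ 0 := by
              have : ∑ y, (β - f y) * ind B y = - ∑ y, (f y - β) * ind B y := by
                rw [← Finset.sum_neg_distrib]; exact Finset.sum_congr rfl fun _ _ => by ring
              rw [this, hmean]; simp
            have h4 : (β - f y) * ind B y ≤ ∑ y, (β - f y) * ind B y :=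
              Finset.single_le_sum (f := fun y => (β - f y) * ind B y)
                (fun z _ => mul_nonneg (by linarith [hf1 z]) (ind_nonneg _ _)) (Finset.mem_univ y)
            rw [h1] at h4
            linarith [hf1 y]
          linarith [hf0 (y + φ t)]
      rw [Finset.sum_add_distrib, Finset.sum_sub_distrib, Finset.sum_const, nsmul_eq_mul] at h2
      have := hγ y
      rw [h1]
      simp only [hD]
      linarith
    · have h1 : ind B y = 0 := by simp [ind, hy]
      rw [h1, mul_zero, zero_add]
      refine Finset.sum_le_sum fun t _ => ?_
      rw [h1, sub_zero, abs_of_nonneg (ind_nonneg _ _)]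
      exact mul_le_of_le_one_left (ind_nonneg _ _) (by linarith [hf1 (y + φ t)])
  have hFabs : ∀ y, |F y| ≤ 2 * ((γ - β) * #T * ind B y + D y) - F y := by
    intro y
    have hD0 : 0 ≤ D y := Finset.sum_nonneg fun _ _ => abs_nonneg _
    have hI : 0 ≤ (γ - β) * #T * ind B y :=
      mul_nonneg (mul_nonneg (by linarith) (by positivity)) (ind_nonneg _ _)
    rw [abs_le]
    constructor <;> linarith [hFD y]
  calc ∑ y, |F y| ≤ ∑ y, (2 * ((γ - β) * #T * ind B y + D y) - F y) :=
        Finset.sum_le_sum fun y _ => hFabs y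
    _ = 2 * ((γ - β) * #T * #B + ∑ y, D y) := by
        rw [Finset.sum_sub_distrib, hFsum, ← Finset.mul_sum, Finset.sum_add_distrib,
          ← Finset.mul_sum, sum_ind, sub_zero]
    _ ≤ _ := by nlinarith

lemma sum_norm_sq_fourier (g : G → ℝ) :
    ∑ ψ : AddChar G ℂ, ‖∑ x, (g x : ℂ) * ψ x‖ ^ 2 = Fintype.card G * ∑ x, g x ^ 2 := by
  have key : ∀ ψ : AddChar G ℂ, ((‖∑ x, (g x : ℂ) * ψ x‖ ^ 2 : ℝ) : ℂ)
      = ∑ x, ∑ z, (g x : ℂ) * g z * ψ (x - z) := by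
    intro ψ
    rw [Complex.ofReal_pow, ← Complex.mul_conj', map_sum, Finset.sum_mul_sum]
    refine Finset.sum_congr rfl fun x _ => Finset.sum_congr rfl fun z _ => ?_
    rw [map_mul, Complex.conj_ofReal, sub_eq_add_neg, AddChar.map_add_eq_mul,
      AddChar.map_neg_eq_conj]
    ring
  apply Complex.ofReal_injective
  rw [Complex.ofReal_sum, Finset.sum_congr rfl fun ψ _ => key ψ, Finset.sum_comm]
  rw [Complex.ofReal_mul, Complex.ofReal_sum, Finset.mul_sum]
  refine Finset.sum_congr rfl fun x _ => ?_
  rw [Finset.sum_comm]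
  simp_rw [← Finset.mul_sum, AddChar.sum_apply_eq_ite, sub_eq_zero]
  simp
  ring

/-- The count of `x + z = 2y` weighted by `g`, `g`, `h`, in terms of the Fourier transform of
`h`. -/
lemma abs_sum_conv_le {h g : G → ℝ} {M : ℝ}
    (hM : ∀ χ : AddChar G ℂ, ‖∑ y, (h y : ℂ) * χ y‖ ≤ M) :
    |∑ y, h y * ∑ x, g x * g (y + y - x)| ≤ M * ∑ x, g x ^ 2 := by
  have hcard : (0 : ℝ) < Fintype.card G := by exact_mod_cast Fintype.card_pos
  have key : ((Fintype.card G * ∑ y, h y * ∑ x, g x * g (y + y - x) : ℝ) : ℂ)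
      = ∑ ψ : AddChar G ℂ, (∑ x, (g x : ℂ) * ψ x) ^ 2 * ∑ y, (h y : ℂ) * (ψ⁻¹ * ψ⁻¹) y := by
    have h1 : ∀ ψ : AddChar G ℂ,
        (∑ x, (g x : ℂ) * ψ x) ^ 2 * ∑ y, (h y : ℂ) * (ψ⁻¹ * ψ⁻¹) y
        = ∑ y, ∑ x, ∑ z, (h y : ℂ) * g x * g z * ψ (x + z - (y + y)) := by
      intro ψ
      rw [sq, Finset.sum_mul_sum, Finset.mul_sum]
      refine Finset.sum_congr rfl fun y _ => ?_
      rw [Finset.sum_mul]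
      refine Finset.sum_congr rfl fun x _ => ?_
      rw [Finset.sum_mul]
      refine Finset.sum_congr rfl fun z _ => ?_
      rw [AddChar.mul_apply, AddChar.inv_apply]
      have : ψ (x + z - (y + y)) = ψ x * ψ z * (ψ (-y) * ψ (-y)) := by
        rw [← AddChar.map_add_eq_mul, ← AddChar.map_add_eq_mul, ← AddChar.map_add_eq_mul]
        congr 1; abel
      rw [this]; ring
    rw [Finset.sum_congr rfl fun ψ _ => h1 ψ, Finset.sum_comm]
    push_cast
    rw [Finset.mul_sum]
    refine Finset.sum_congr rfl fun y _ => ?_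
    rw [Finset.sum_comm, Finset.mul_sum, Finset.mul_sum]
    refine Finset.sum_congr rfl fun x _ => ?_
    rw [Finset.sum_comm]
    simp_rw [← Finset.mul_sum, AddChar.sum_apply_eq_ite, sub_eq_zero]
    rw [Finset.sum_eq_single (y + y - x)]
    · simp; ring
    · intro z _ hz
      rw [if_neg, mul_zero]
      intro h; apply hz; rw [← h]; abel
    · simp
  have hb : Fintype.card G * |∑ y, h y * ∑ x, g x * g (y + y - x)|
      ≤ Fintype.card G * (M * ∑ x, g x ^ 2) := by
    calc Fintype.card G * |∑ y, h y * ∑ x, g x * g (y + y - x)|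
        = ‖((Fintype.card G * ∑ y, h y * ∑ x, g x * g (y + y - x) : ℝ) : ℂ)‖ := by
          rw [Complex.norm_real, Real.norm_eq_abs, abs_mul, abs_of_pos hcard]
      _ ≤ ∑ ψ : AddChar G ℂ, ‖∑ x, (g x : ℂ) * ψ x‖ ^ 2 * M := by
          rw [key]
          refine (norm_sum_le _ _).trans (Finset.sum_le_sum fun ψ _ => ?_)
          rw [norm_mul, norm_pow]
          exact mul_le_mul_of_nonneg_left (hM _) (by positivity)
      _ = _ := by rw [← Finset.sum_mul, sum_norm_sq_fourier]; ring
  exact le_of_mul_le_mul_left hb hcard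

omit [DecidableEq G] in
/-- A function on `B` whose averages along a set `T`, on which `χ` is nearly constant, are small
in `L¹` has a small Fourier coefficient at `χ`. -/
lemma norm_sum_mul_char_le {T : Finset G} {h : G → ℝ} {χ : AddChar G ℂ} {c η b : ℝ}
    (hT : T.Nonempty) (hχ : ∀ t ∈ T, ‖1 - χ t‖ ≤ η) (hη : 0 ≤ η) (hh : ∑ y, |h y| ≤ b)
    (havg : ∑ y, |∑ t ∈ T, h (y + t)| ≤ c * #T) :
    ‖∑ y, (h y : ℂ) * χ y‖ ≤ c + η * b := by
  have hT0 : (0 : ℝ) < #T := by exact_mod_cast hT.card_pos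
  have key : (#T : ℂ) * ∑ y, (h y : ℂ) * χ y
      = ∑ y, χ y * ((∑ t ∈ T, h (y + t) : ℝ) : ℂ)
        - ∑ t ∈ T, ∑ y, (h (y + t) : ℂ) * χ y * (1 - χ t) := by
    have h1 : (#T : ℂ) * ∑ y, (h y : ℂ) * χ y
        = ∑ t ∈ T, ∑ y, (h (y + t) : ℂ) * χ (y + t) := by
      rw [← nsmul_eq_mul, ← Finset.sum_const]
      refine Finset.sum_congr rfl fun t _ => ?_
      exact (Equiv.sum_comp (Equiv.addRight t) (fun y => (h y : ℂ) * χ y)).symm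
    have h2 : ∑ y, χ y * ((∑ t ∈ T, h (y + t) : ℝ) : ℂ)
        = ∑ t ∈ T, ∑ y, (h (y + t) : ℂ) * χ y := by
      rw [Finset.sum_comm]
      refine Finset.sum_congr rfl fun y _ => ?_
      rw [Complex.ofReal_sum, Finset.mul_sum]
      exact Finset.sum_congr rfl fun t _ => mul_comm _ _
    rw [h1, h2, ← Finset.sum_sub_distrib]
    refine Finset.sum_congr rfl fun t _ => ?_
    rw [← Finset.sum_sub_distrib]
    refine Finset.sum_congr rfl fun y _ => ?_
    rw [AddChar.map_add_eq_mul]; ring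
  have hb : #T * ‖∑ y, (h y : ℂ) * χ y‖ ≤ #T * (c + η * b) := by
    calc #T * ‖∑ y, (h y : ℂ) * χ y‖ = ‖(#T : ℂ) * ∑ y, (h y : ℂ) * χ y‖ := by
          rw [norm_mul, Complex.norm_natCast]
      _ ≤ ∑ y, |∑ t ∈ T, h (y + t)| + ∑ t ∈ T, η * b := by
          rw [key]
          refine (norm_sub_le _ _).trans (add_le_add ?_ ?_)
          · refine (norm_sum_le _ _).trans (Finset.sum_le_sum fun y _ => ?_)
            rw [norm_mul, AddChar.norm_apply, one_mul, Complex.norm_real, Real.norm_eq_abs]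
          · refine (norm_sum_le _ _).trans (Finset.sum_le_sum fun t ht => ?_)
            calc ‖∑ y, (h (y + t) : ℂ) * χ y * (1 - χ t)‖ ≤ ∑ y, |h (y + t)| * η := by
                  refine (norm_sum_le _ _).trans (Finset.sum_le_sum fun y _ => ?_)
                  rw [norm_mul, norm_mul, AddChar.norm_apply, mul_one, Complex.norm_real,
                    Real.norm_eq_abs]
                  exact mul_le_mul_of_nonneg_left (hχ t ht) (abs_nonneg _)
              _ = η * ∑ y, |h y| := by
                  rw [← Finset.sum_mul, mul_comm]
                  congr 1
                  exact Equiv.sum_comp (Equiv.addRight t) (fun y => |h y|)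
              _ ≤ η * b := mul_le_mul_of_nonneg_left hh hη
      _ ≤ _ := by
          rw [Finset.sum_const, nsmul_eq_mul]
          linarith
  exact le_of_mul_le_mul_left hb hT0

lemma increment_arith {α η ε a₁ a₂ b₁ b₂ : ℝ} (hα : 0 < α) (hα1 : α ≤ 1) (hη : η = α ^ 2 / 100)
    (hε0 : 0 ≤ ε) (hε : ε ≤ η) (ha₁ : a₁ ≤ α + η) (ha₂ : a₂ ≤ α + η)
    (ha : 2 * (α - ε) ≤ a₁ + a₂) (hb₁ : 1 ≤ η * b₁) (hb₂ : 0 < b₂)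
    (h : a₂ * b₂ * ((a₁ ^ 2 * (1 - ε) - 2 * a₁ * ε) * b₁)
      - a₂ * (2 * (α + η - a₁ + ε) * (b₁ * b₂))
      - (2 * (α + η - a₂ + ε) + η) * b₂ * (a₁ * b₁) ≤ a₂ * b₂) : False := by
  have hη0 : 0 < η := by rw [hη]; positivity
  have hb₁0 : 0 < b₁ := by
    by_contra hc; push Not at hc; nlinarith
  have hηα : η ≤ α / 100 := by rw [hη]; nlinarith
  have l₁ : α - 3 * η ≤ a₁ := by linarith
  have l₂ : α - 3 * η ≤ a₂ := by linarith
  have p₁ : 97 / 100 * α ≤ a₁ := by linarith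
  have p₂ : 97 / 100 * α ≤ a₂ := by linarith
  have q₁ : a₁ ≤ 101 / 100 * α := by linarith
  have q₂ : a₂ ≤ 101 / 100 * α := by linarith
  have h2 : a₂ * ((a₁ ^ 2 * (1 - ε) - 2 * a₁ * ε))
      - a₂ * (2 * (α + η - a₁ + ε)) - (2 * (α + η - a₂ + ε) + η) * a₁ ≤ a₂ * η := by
    have hbb : 0 < b₁ * b₂ := by positivity
    have : a₂ * b₂ ≤ a₂ * b₂ * (η * b₁) :=
      le_mul_of_one_le_right (mul_nonneg (by linarith) hb₂.le) hb₁
    refine le_of_mul_le_mul_right ?_ hbb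
    linarith
  have h3 : 9 / 10 * α ^ 2 ≤ a₁ ^ 2 * (1 - ε) - 2 * a₁ * ε := by
    have e1 : (97 / 100 * α) ^ 2 ≤ a₁ ^ 2 := pow_le_pow_left₀ (by positivity) p₁ 2
    have e2 : 99 / 100 ≤ 1 - ε := by linarith
    have e3 : (97 / 100 * α) ^ 2 * (99 / 100) ≤ a₁ ^ 2 * (1 - ε) :=
      mul_le_mul e1 e2 (by norm_num) (by positivity)
    have e4 : a₁ * ε ≤ (101 / 100) * (α ^ 2 / 100) :=
      mul_le_mul (by linarith) (by linarith) hε0 (by norm_num)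
    nlinarith
  have h4 : 97 / 100 * α * (9 / 10 * α ^ 2) ≤ a₂ * (a₁ ^ 2 * (1 - ε) - 2 * a₁ * ε) :=
    mul_le_mul p₂ h3 (by positivity) (by linarith)
  have h5 : a₂ * (2 * (α + η - a₁ + ε)) ≤ (101 / 100 * α) * (10 * η) :=
    mul_le_mul q₂ (by linarith) (by linarith) (by positivity)
  have h6 : (2 * (α + η - a₂ + ε) + η) * a₁ ≤ 11 * η * (101 / 100 * α) :=
    mul_le_mul (by linarith) q₁ (by linarith) (by positivity)
  have h7 : a₂ * η ≤ 101 / 100 * α * η := mul_le_mul_of_nonneg_right q₂ hη0.le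
  have h8 : α * η = α ^ 3 / 100 := by rw [hη]; ring
  have h9 : 0 < α ^ 3 := by positivity
  nlinarith

omit [AddCommGroup G] in
/-- The balanced function `(f - a) 1_B` has mean zero when `a` is the average of `f` over `B`. -/
lemma sum_balanced {B : Finset G} {f : G → ℝ} {a : ℝ} (h : ∑ x ∈ B, f x = a * #B) :
    ∑ y, (f y - a) * ind B y = 0 := by
  rw [sum_mul_ind, Finset.sum_sub_distrib, h, Finset.sum_const, nsmul_eq_mul]; ring

omit [AddCommGroup G] in
lemma sum_abs_balanced_le {B : Finset G} {f : G → ℝ} {a : ℝ} (hf0 : ∀ x, 0 ≤ f x)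
    (hf1 : ∀ x, f x ≤ 1) (ha0 : 0 ≤ a) (ha1 : a ≤ 1) :
    ∑ y, |(f y - a) * ind B y| ≤ #B := by
  rw [← sum_ind]
  refine Finset.sum_le_sum fun y _ => ?_
  rw [abs_mul, abs_of_nonneg (ind_nonneg _ _)]
  refine mul_le_of_le_one_left (ind_nonneg _ _) ?_
  rw [abs_le]; constructor <;> linarith [hf0 y, hf1 y]

omit [AddCommGroup G] in
lemma sum_sq_balanced_le {B : Finset G} {f : G → ℝ} {a : ℝ} (hf0 : ∀ x, 0 ≤ f x)
    (hf1 : ∀ x, f x ≤ 1) (h : ∑ x ∈ B, f x = a * #B) :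
    ∑ y, ((f y - a) * ind B y) ^ 2 ≤ a * #B := by
  have h1 : ∑ y, ((f y - a) * ind B y) ^ 2 = ∑ y ∈ B, (f y - a) ^ 2 := by
    rw [← sum_mul_ind B]
    refine Finset.sum_congr rfl fun y _ => ?_
    unfold ind; split_ifs <;> ring
  rw [h1]
  calc ∑ y ∈ B, (f y - a) ^ 2 ≤ ∑ y ∈ B, (f y - 2 * a * f y + a ^ 2) :=
        Finset.sum_le_sum fun y _ => by nlinarith [hf0 y, hf1 y]
    _ = a * #B - a ^ 2 * #B := by
        rw [Finset.sum_add_distrib, Finset.sum_sub_distrib, ← Finset.mul_sum, h, Finset.sum_const,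
          nsmul_eq_mul]
        ring
    _ ≤ a * #B := by nlinarith [mul_nonneg (sq_nonneg a) (Nat.cast_nonneg (α := ℝ) #B)]

/-- Lower bound for the number of ways of writing `2y` as `x + z` with `x, z ∈ B`, weighted by `f`,
when `B` is symmetric and nearly invariant under translation by `2y`. -/
lemma le_sum_conv {B T : Finset G} {f : G → ℝ} {a ε : ℝ} {w : G} (hf0 : ∀ x, 0 ≤ f x)
    (hf1 : ∀ x, f x ≤ 1) (ha0 : 0 ≤ a) (ha1 : a ≤ 1) (h : ∑ x ∈ B, f x = a * #B)
    (hsymm : ∀ x ∈ B, -x ∈ B) (hB : AlmostInvariant B T ε) (hw : w ∈ T) :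
    (a ^ 2 * (1 - ε) - 2 * a * ε) * #B
        + ∑ x, ((f x - a) * ind B x) * ((f (w - x) - a) * ind B (w - x))
      ≤ ∑ x, (f x * ind B x) * (f (w - x) * ind B (w - x)) := by
  have hneg : ∀ x, ind B (-x) = ind B x := by
    intro x
    have : -x ∈ B ↔ x ∈ B := ⟨fun h => by simpa using hsymm _ h, hsymm x⟩
    simp [ind, this]
  set g : G → ℝ := fun x => (f x - a) * ind B x with hg
  have hgabs : ∀ x, |g x| ≤ 1 := by
    intro x
    simp only [hg]
    rw [abs_mul, abs_of_nonneg (ind_nonneg _ _)]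
    refine mul_le_one₀ ?_ (ind_nonneg _ _) (ind_le_one _ _)
    rw [abs_le]; constructor <;> linarith [hf0 x, hf1 x]
  have hinv := hB w hw
  have shift : ∀ u : G → ℝ, (∀ x, |u x| ≤ 1) →
      ∑ x, u x * ind B x - ε * #B ≤ ∑ x, u x * ind B (w - x) := by
    intro u hu
    have : ∑ x, u x * ind B x - ∑ x, u x * ind B (w - x)
        ≤ ∑ x, |ind B (x + w) - ind B x| := by
      rw [← Finset.sum_sub_distrib, ← Equiv.sum_comp (Equiv.subRight w)
        (fun x => |ind B (x + w) - ind B x|)]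
      refine Finset.sum_le_sum fun x _ => ?_
      have e1 : ind B (w - x) = ind B (x - w) := by rw [← hneg, neg_sub]
      simp only [Equiv.subRight_apply, sub_add_cancel]
      rw [e1, ← mul_sub]
      refine (le_abs_self _).trans ?_
      rw [abs_mul]
      exact mul_le_of_le_one_left (abs_nonneg _) (hu x)
    linarith
  have h1 : #B - ε * #B ≤ ∑ x, ind B x * ind B (w - x) := by
    have := shift (ind B) (fun x => by rw [abs_of_nonneg (ind_nonneg _ _)]; exact ind_le_one _ _)
    have e : ∑ x, ind B x * ind B x = #B := by
      rw [← sum_ind]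
      exact Finset.sum_congr rfl fun x _ => by unfold ind; split_ifs <;> simp
    linarith
  have h2 : - (ε * #B) ≤ ∑ x, g x * ind B (w - x) := by
    have := shift g hgabs
    have e : ∑ x, g x * ind B x = 0 := by
      rw [← sum_balanced h]
      exact Finset.sum_congr rfl fun x _ => by simp only [hg]; unfold ind; split_ifs <;> simp
    linarith
  have h3 : ∑ x, ind B x * g (w - x) = ∑ x, g x * ind B (w - x) := by
    rw [← Equiv.sum_comp (Equiv.subLeft w)]
    refine Finset.sum_congr rfl fun x _ => ?_
    simp only [Equiv.subLeft_apply, sub_sub_cancel]; ring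
  have h4 : ∑ x, (f x * ind B x) * (f (w - x) * ind B (w - x))
      = a ^ 2 * ∑ x, ind B x * ind B (w - x) + a * ∑ x, g x * ind B (w - x)
        + a * ∑ x, ind B x * g (w - x) + ∑ x, g x * g (w - x) := by
    simp only [Finset.mul_sum, ← Finset.sum_add_distrib]
    refine Finset.sum_congr rfl fun x _ => ?_
    simp only [hg]; ring
  rw [h4, h3]
  have := mul_le_mul_of_nonneg_left h1 (sq_nonneg a)
  have := mul_le_mul_of_nonneg_left h2 ha0
  linarith

/-- One step of the density increment strategy: a progression-free set of density `α` on `B₀` has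
density more than `α + α ^ 2 / 100` on a translate of one of the given smaller sets. -/
theorem density_increment {A B₀ B₁ B₂ : Finset G} {α η ε : ℝ} (hA : ThreeAPFree (A : Set G))
    (hα : 0 < α) (hη : η = α ^ 2 / 100) (hε0 : 0 ≤ ε) (hε : ε ≤ η)
    (h₀ : B₀.Nonempty) (h₁ : 1 ≤ η * #B₁) (h₂ : B₂.Nonempty)
    (hdens : ∑ x ∈ B₀, ind A x = α * #B₀)
    (h₀₁ : AlmostInvariant B₀ B₁ ε) (h₀₂ : AlmostInvariant B₀ B₂ ε)
    (hsymm : ∀ x ∈ B₁, -x ∈ B₁) (h₁₂ : AlmostInvariant B₁ (B₂.image fun y => y + y) ε)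
    (hB₁ : ∀ x, ∑ t ∈ B₁, ind A (x + t) ≤ (α + η) * #B₁)
    (hB₂ : ∀ x, ∑ t ∈ B₂, ind A (x + t) ≤ (α + η) * #B₂)
    (hB₂' : ∀ x, ∑ t ∈ B₂, ind A (x + (t + t)) ≤ (α + η) * #B₂)
    (hχ : ∀ χ : AddChar G ℂ, ∃ B₃ : Finset G, B₃.Nonempty ∧ (∀ t ∈ B₃, ‖1 - χ t‖ ≤ η) ∧
      AlmostInvariant B₂ B₃ ε ∧ ∀ x, ∑ t ∈ B₃, ind A (x + t) ≤ (α + η) * #B₃) : False := by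
  have hη0 : 0 < η := by rw [hη]; positivity
  have hb₀ : (0 : ℝ) < #B₀ := by exact_mod_cast h₀.card_pos
  have hb₂ : (0 : ℝ) < #B₂ := by exact_mod_cast h₂.card_pos
  have hb₁ : (0 : ℝ) < #B₁ := by
    by_contra hc; push Not at hc; nlinarith
  have hα1 : α ≤ 1 := by
    have : ∑ x ∈ B₀, ind A x ≤ ∑ x ∈ B₀, 1 := Finset.sum_le_sum fun x _ => ind_le_one _ _
    rw [hdens, Finset.sum_const, nsmul_eq_mul] at this
    exact le_of_mul_le_mul_right (by linarith) hb₀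
  have habs : ∀ x, |ind A x| ≤ 1 := fun x => by
    rw [abs_of_nonneg (ind_nonneg _ _)]; exact ind_le_one _ _
  obtain ⟨w, -, hw⟩ : ∃ w ∈ B₀, 2 * (α - ε) ≤
      (∑ t ∈ B₁, ind A (w + t)) / #B₁ + (∑ t ∈ B₂, ind A (w + t)) / #B₂ := by
    refine Finset.exists_le_of_sum_le h₀ ?_
    rw [Finset.sum_add_distrib, ← Finset.sum_div, ← Finset.sum_div, Finset.sum_const, nsmul_eq_mul]
    have e₁ := le_sum_translates h₀₁ habs
    have e₂ := le_sum_translates h₀₂ habs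
    rw [hdens] at e₁ e₂
    have e₁' : (α - ε) * #B₀ ≤ (∑ x ∈ B₀, ∑ t ∈ B₁, ind A (x + t)) / #B₁ := by
      rw [le_div_iff₀ hb₁]; linarith
    have e₂' : (α - ε) * #B₀ ≤ (∑ x ∈ B₀, ∑ t ∈ B₂, ind A (x + t)) / #B₂ := by
      rw [le_div_iff₀ hb₂]; linarith
    linarith
  set f : G → ℝ := fun x => ind A (w + x) with hf
  have hf0 : ∀ x, 0 ≤ f x := fun x => ind_nonneg _ _
  have hf1 : ∀ x, f x ≤ 1 := fun x => ind_le_one _ _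
  set a₁ := (∑ t ∈ B₁, ind A (w + t)) / #B₁ with ha₁
  set a₂ := (∑ t ∈ B₂, ind A (w + t)) / #B₂ with ha₂
  have hs₁ : ∑ t ∈ B₁, f t = a₁ * #B₁ := by rw [ha₁, div_mul_cancel₀ _ hb₁.ne']
  have hs₂ : ∑ t ∈ B₂, f t = a₂ * #B₂ := by rw [ha₂, div_mul_cancel₀ _ hb₂.ne']
  have hu₁ : a₁ ≤ α + η := by rw [ha₁, div_le_iff₀ hb₁]; exact hB₁ w
  have hu₂ : a₂ ≤ α + η := by rw [ha₂, div_le_iff₀ hb₂]; exact hB₂ w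
  have hp₁ : 0 ≤ a₁ := div_nonneg (Finset.sum_nonneg fun x _ => hf0 x) hb₁.le
  have hp₂ : 0 ≤ a₂ := div_nonneg (Finset.sum_nonneg fun x _ => hf0 x) hb₂.le
  have hq : ∀ B : Finset G, 0 < (#B : ℝ) → (∑ t ∈ B, ind A (w + t)) / #B ≤ 1 := by
    intro B hB
    rw [div_le_iff₀ hB, one_mul, ← nsmul_one, ← Finset.sum_const]
    exact Finset.sum_le_sum fun x _ => ind_le_one _ _
  have hq₁ : a₁ ≤ 1 := hq _ hb₁
  have hq₂ : a₂ ≤ 1 := hq _ hb₂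
  set g : G → ℝ := fun x => (f x - a₁) * ind B₁ x with hg
  set h : G → ℝ := fun x => (f x - a₂) * ind B₂ x with hh
  set conv : G → ℝ := fun y => ∑ x, g x * g (y + y - x) with hconv
  -- the structured part
  have hP₁ : |∑ y ∈ B₂, conv y| ≤ 2 * (α + η - a₁ + ε) * (#B₁ * #B₂) := by
    have hL := sum_abs_sum_balanced_le (φ := fun y => y + y) h₁₂ hf0 hf1 hp₁ hu₁ (sum_balanced hs₁)
      (fun y => by simpa only [hf, add_assoc] using hB₂' (w + y))
    refine le_trans ?_ hL
    rw [hconv, Finset.sum_comm, ← Equiv.sum_comp (Equiv.neg G) (fun y =>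
      |∑ t ∈ B₂, (f (y + (t + t)) - a₁) * ind B₁ (y + (t + t))|)]
    refine (Finset.abs_sum_le_sum_abs _ _).trans (Finset.sum_le_sum fun x _ => ?_)
    rw [← Finset.mul_sum, abs_mul]
    have e : ∑ y ∈ B₂, g (y + y - x)
        = ∑ t ∈ B₂, (f ((Equiv.neg G) x + (t + t)) - a₁) * ind B₁ ((Equiv.neg G) x + (t + t)) := by
      refine Finset.sum_congr rfl fun y _ => ?_
      have : y + y - x = (Equiv.neg G) x + (y + y) := by simp only [Equiv.neg_apply]; abel
      rw [this]
    rw [e]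
    refine mul_le_of_le_one_left (abs_nonneg _) ?_
    simp only [hg]
    rw [abs_mul, abs_of_nonneg (ind_nonneg _ _)]
    refine mul_le_one₀ ?_ (ind_nonneg _ _) (ind_le_one _ _)
    rw [abs_le]; constructor <;> linarith [hf0 x, hf1 x]
  -- the part with a large Fourier coefficient
  have hP₂ : |∑ y, h y * conv y| ≤ (2 * (α + η - a₂ + ε) + η) * #B₂ * (a₁ * #B₁) := by
    have hM : ∀ χ : AddChar G ℂ,
        ‖∑ y, (h y : ℂ) * χ y‖ ≤ (2 * (α + η - a₂ + ε) + η) * #B₂ := by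
      intro χ
      obtain ⟨B₃, hne, hχ₃, hinv, hinc⟩ := hχ χ
      have hL := sum_abs_sum_balanced_le (φ := fun y => y) (T := B₃) (B := B₂)
        (by simpa using hinv) hf0 hf1 hp₂ hu₂ (sum_balanced hs₂)
        (fun y => by simpa only [hf, add_assoc] using hinc (w + y))
      have := norm_sum_mul_char_le (h := h) (c := 2 * (α + η - a₂ + ε) * #B₂) hne hχ₃ hη0.le
        (sum_abs_balanced_le hf0 hf1 hp₂ hq₂) (by rw [mul_assoc]; exact hL)
      linarith
    refine (abs_sum_conv_le hM).trans ?_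
    refine mul_le_mul_of_nonneg_left (sum_sq_balanced_le hf0 hf1 hs₁) ?_
    exact mul_nonneg (by linarith) hb₂.le
  have hT : ∀ y, f y * ∑ x, (f x * ind B₁ x) * (f (y + y - x) * ind B₁ (y + y - x)) ≤ f y := by
    intro y
    by_cases hy : w + y ∈ A
    · have h1 : f y = 1 := by simp [hf, ind, hy]
      rw [h1, one_mul, Finset.sum_eq_single y]
      · exact mul_le_one₀ (mul_le_one₀ (hf1 _) (ind_nonneg _ _) (ind_le_one _ _))
          (mul_nonneg (hf0 _) (ind_nonneg _ _))
          (mul_le_one₀ (hf1 _) (ind_nonneg _ _) (ind_le_one _ _))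
      · intro x _ hx
        by_cases hxA : w + x ∈ A
        · by_cases hzA : w + (y + y - x) ∈ A
          · exact absurd (add_left_cancel (hA hxA hy hzA (by abel))) hx
          · simp [hf, ind, hzA]
        · simp [hf, ind, hxA]
      · simp
    · have h1 : f y = 0 := by simp [hf, ind, hy]
      rw [h1, zero_mul]
  have hmain : a₂ * #B₂ * ((a₁ ^ 2 * (1 - ε) - 2 * a₁ * ε) * #B₁) + ∑ y ∈ B₂, f y * conv y
      ≤ a₂ * #B₂ := by
    rw [← hs₂, Finset.sum_mul, ← Finset.sum_add_distrib]
    refine Finset.sum_le_sum fun y hy => ?_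
    refine le_trans ?_ (hT y)
    rw [← mul_add]
    exact mul_le_mul_of_nonneg_left (le_sum_conv hf0 hf1 hp₁ hq₁ hs₁ hsymm h₁₂
      (Finset.mem_image_of_mem (fun y => y + y) hy)) (hf0 y)
  have hsplit : ∑ y ∈ B₂, f y * conv y = a₂ * ∑ y ∈ B₂, conv y + ∑ y, h y * conv y := by
    rw [← sum_ind_mul B₂ fun y => f y * conv y, ← sum_ind_mul B₂ conv, Finset.mul_sum, ← Finset.sum_add_distrib]
    refine Finset.sum_congr rfl fun y _ => ?_
    simp only [hh]; ring
  rw [hsplit] at hmain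
  have e₁ := mul_le_mul_of_nonneg_left (abs_le.1 hP₁).1 hp₂
  have e₂ := (abs_le.1 hP₂).1
  exact increment_arith hα hα1 hη hε0 hε hu₁ hu₂ hw h₁ hb₂ (by linarith)

/-- The Bohr set of radius `ρ` with frequency set `Γ`. -/
noncomputable def bohr (Γ : Finset (AddChar G ℂ)) (ρ : ℝ) : Finset G :=
  {x | ∀ ψ ∈ Γ, ‖1 - ψ x‖ ≤ ρ}

omit [DecidableEq G] in
lemma mem_bohr {Γ : Finset (AddChar G ℂ)} {ρ : ℝ} {x : G} :
    x ∈ bohr Γ ρ ↔ ∀ ψ ∈ Γ, ‖1 - ψ x‖ ≤ ρ := by simp [bohr]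

omit [DecidableEq G] in
lemma bohr_subset {Γ Δ : Finset (AddChar G ℂ)} {ρ σ : ℝ} (hΓ : Γ ⊆ Δ) (hρ : σ ≤ ρ) :
    bohr Δ σ ⊆ bohr Γ ρ := fun _ hx =>
  mem_bohr.2 fun ψ hψ => (mem_bohr.1 hx ψ (hΓ hψ)).trans hρ

omit [DecidableEq G] in
lemma zero_mem_bohr {Γ : Finset (AddChar G ℂ)} {ρ : ℝ} (hρ : 0 ≤ ρ) : (0 : G) ∈ bohr Γ ρ :=
  mem_bohr.2 fun ψ _ => by simpa using hρ

omit [DecidableEq G] in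
lemma add_mem_bohr {Γ : Finset (AddChar G ℂ)} {ρ σ : ℝ} {x y : G} (hx : x ∈ bohr Γ ρ)
    (hy : y ∈ bohr Γ σ) : x + y ∈ bohr Γ (ρ + σ) := by
  refine mem_bohr.2 fun ψ hψ => ?_
  have : 1 - ψ (x + y) = (1 - ψ x) + ψ x * (1 - ψ y) := by rw [AddChar.map_add_eq_mul]; ring
  rw [this]
  refine (norm_add_le _ _).trans (add_le_add (mem_bohr.1 hx ψ hψ) ?_)
  rw [norm_mul, AddChar.norm_apply, one_mul]
  exact mem_bohr.1 hy ψ hψ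

omit [DecidableEq G] in
lemma neg_mem_bohr {Γ : Finset (AddChar G ℂ)} {ρ : ℝ} {x : G} (hx : x ∈ bohr Γ ρ) :
    -x ∈ bohr Γ ρ := by
  refine mem_bohr.2 fun ψ hψ => ?_
  have : 1 - ψ (-x) = -(ψ (-x) * (1 - ψ x)) := by
    have : ψ (-x) * ψ x = 1 := by rw [← AddChar.map_add_eq_mul]; simp
    rw [mul_sub, this]; ring
  rw [this, norm_neg, norm_mul, AddChar.norm_apply, one_mul]
  exact mem_bohr.1 hx ψ hψ

omit [DecidableEq G] in
/-- Pigeonhole for one character: some large subset of `S` has nearly constant `ψ`. -/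
lemma exists_subset_char_close (S : Finset G) (ψ : AddChar G ℂ) {n : ℕ} (hn : 0 < n) :
    ∃ S' ⊆ S, #S ≤ (2 * n + 1) ^ 2 * #S' ∧ ∀ x ∈ S', ∀ y ∈ S', ‖1 - ψ (x - y)‖ ≤ 2 / n := by
  have hn' : (0 : ℝ) < n := by exact_mod_cast hn
  set cell : G → ℤ × ℤ := fun x => (⌊n * (ψ x).re⌋, ⌊n * (ψ x).im⌋) with hcell
  set I : Finset (ℤ × ℤ) := Finset.Icc (-n : ℤ) n ×ˢ Finset.Icc (-n : ℤ) n with hI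
  have hfloor : ∀ r : ℝ, |r| ≤ 1 → ⌊n * r⌋ ∈ Finset.Icc (-n : ℤ) n := by
    intro r hr
    rw [abs_le] at hr
    rw [Finset.mem_Icc, Int.le_floor]
    constructor
    · push_cast; nlinarith
    · have : (⌊n * r⌋ : ℝ) ≤ n := (Int.floor_le _).trans (by nlinarith)
      exact_mod_cast this
  have hmaps : ∀ x ∈ S, cell x ∈ I := by
    intro x _
    have h1 : ‖ψ x‖ = 1 := AddChar.norm_apply ψ x
    exact Finset.mem_product.2 ⟨hfloor _ (h1 ▸ Complex.abs_re_le_norm _),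
      hfloor _ (h1 ▸ Complex.abs_im_le_norm _)⟩
  have hIcard : #I = (2 * n + 1) ^ 2 := by
    rw [hI, Finset.card_product, Int.card_Icc]
    have : ((n : ℤ) + 1 - -n).toNat = 2 * n + 1 := by omega
    rw [this, sq]
  obtain ⟨c, -, hc⟩ : ∃ c ∈ I, #S ≤ (2 * n + 1) ^ 2 * #{x ∈ S | cell x = c} := by
    have hIne : I.Nonempty := by rw [← Finset.card_pos, hIcard]; positivity
    by_contra hcon
    push Not at hcon
    have h1 := Finset.card_eq_sum_card_fiberwise hmaps
    have h2 : ∑ c ∈ I, (2 * n + 1) ^ 2 * #{x ∈ S | cell x = c} < ∑ c ∈ I, #S :=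
      Finset.sum_lt_sum_of_nonempty hIne hcon
    rw [← Finset.mul_sum, ← h1, Finset.sum_const, hIcard, smul_eq_mul] at h2
    exact lt_irrefl _ h2
  refine ⟨_, Finset.filter_subset _ _, hc, fun x hx y hy => ?_⟩
  rw [Finset.mem_filter] at hx hy
  have hxy : cell x = cell y := hx.2.trans hy.2.symm
  simp only [hcell, Prod.mk.injEq] at hxy
  have hfl : ∀ r s : ℝ, ⌊n * r⌋ = ⌊n * s⌋ → |r - s| ≤ 1 / n := by
    intro r s h
    have := (Int.abs_sub_lt_one_of_floor_eq_floor h).le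
    rw [← mul_sub, abs_mul, abs_of_pos hn'] at this
    rw [le_div_iff₀ hn']; linarith
  have e : 1 - ψ (x - y) = -(ψ (-y) * (ψ x - ψ y)) := by
    have : ψ (-y) * ψ y = 1 := by rw [← AddChar.map_add_eq_mul]; simp
    rw [sub_eq_add_neg x y, AddChar.map_add_eq_mul, mul_sub, this]; ring
  rw [e, norm_neg, norm_mul, AddChar.norm_apply, one_mul]
  refine (Complex.norm_le_abs_re_add_abs_im _).trans ?_
  rw [Complex.sub_re, Complex.sub_im]
  have h1 := hfl _ _ hxy.1
  have h2 := hfl _ _ hxy.2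
  have : (2 : ℝ) / n = 1 / n + 1 / n := by ring
  linarith

omit [DecidableEq G] in
lemma exists_subset_chars_close (Γ : Finset (AddChar G ℂ)) {n : ℕ} (hn : 0 < n) :
    ∃ S : Finset G, Fintype.card G ≤ (2 * n + 1) ^ (2 * #Γ) * #S ∧
      ∀ x ∈ S, ∀ y ∈ S, x - y ∈ bohr Γ (2 / n) := by
  classical
  induction Γ using Finset.induction_on with
  | empty => exact ⟨Finset.univ, by simp, fun x _ y _ => by simp [bohr]⟩
  | insert ψ Γ hψ ih =>
    obtain ⟨S, hS, hclose⟩ := ih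
    obtain ⟨S', hsub, hS', hclose'⟩ := exists_subset_char_close S ψ hn
    refine ⟨S', ?_, fun x hx y hy => mem_bohr.2 fun χ hχ => ?_⟩
    · rw [Finset.card_insert_of_notMem hψ, mul_add, pow_add, mul_assoc]
      exact hS.trans (Nat.mul_le_mul_left _ hS')
    · rcases Finset.mem_insert.1 hχ with rfl | hχ
      · exact hclose' x hx y hy
      · exact mem_bohr.1 (hclose x (hsub hx) y (hsub hy)) χ hχ

omit [DecidableEq G] in
lemma card_le_mul_card_bohr (Γ : Finset (AddChar G ℂ)) {n : ℕ} (hn : 0 < n) :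
    Fintype.card G ≤ (2 * n + 1) ^ (2 * #Γ) * #(bohr Γ (2 / n)) := by
  obtain ⟨S, hS, hclose⟩ := exists_subset_chars_close Γ hn
  refine hS.trans (Nat.mul_le_mul_left _ ?_)
  rcases S.eq_empty_or_nonempty with rfl | ⟨y, hy⟩
  · simp
  · exact Finset.card_le_card_of_injOn (fun x => x - y) (fun x hx => hclose x hx y hy)
      (fun a _ b _ h => sub_left_injective h)

omit [DecidableEq G] in
lemma card_le_two_pow_mul_card_bohr (Γ : Finset (AddChar G ℂ)) {d e : ℕ} (hΓ : #Γ ≤ d) {ρ : ℝ}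
    (hρ : (1 / 2) ^ e ≤ ρ) : Fintype.card G ≤ 2 ^ (2 * d * (e + 3)) * #(bohr Γ ρ) := by
  refine (card_le_mul_card_bohr Γ (n := 2 ^ (e + 1)) (by positivity)).trans (Nat.mul_le_mul ?_ ?_)
  · calc (2 * 2 ^ (e + 1) + 1) ^ (2 * #Γ) ≤ (2 ^ (e + 3)) ^ (2 * d) := by
          refine (Nat.pow_le_pow_left ?_ _).trans (Nat.pow_le_pow_right (by positivity) (by omega))
          have : 1 ≤ 2 ^ e := Nat.one_le_two_pow
          rw [pow_succ, pow_add]; omega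
      _ = _ := by rw [← pow_mul, mul_comm]
  · refine Finset.card_le_card (bohr_subset subset_rfl (le_trans (le_of_eq ?_) hρ))
    push_cast
    rw [pow_succ, one_div, inv_pow]
    field_simp

lemma exists_small_growth {f : ℕ → ℝ} {n s : ℕ} (hn : 0 < n) (hf : ∀ j, 0 ≤ f j)
    (h : f (n * s) < 2 ^ s * f 0) : ∃ j < n * s, f (j + 1) ≤ (1 + 1 / n) * f j := by
  by_contra! hcon
  have hn' : (0 : ℝ) < n := by exact_mod_cast hn
  have h1 : ∀ j ≤ n * s, (1 + 1 / n : ℝ) ^ j * f 0 ≤ f j := by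
    intro j
    induction j with
    | zero => simp
    | succ j ih =>
      intro hj
      have := ih (by omega)
      rw [pow_succ']
      refine le_trans ?_ (hcon j (by omega)).le
      rw [mul_assoc]
      exact mul_le_mul_of_nonneg_left this (by positivity)
  have h2 : (2 : ℝ) ≤ (1 + 1 / n) ^ n := by
    have := one_add_mul_le_pow (a := (1 / n : ℝ)) (by have : (0:ℝ) ≤ 1 / n := by positivity
                                                      linarith) n
    rw [mul_one_div_cancel hn'.ne'] at this
    linarith
  have h3 := h1 _ le_rfl
  rw [pow_mul] at h3
  have h4 : (2 : ℝ) ^ s * f 0 ≤ ((1 + 1 / n : ℝ) ^ n) ^ s * f 0 :=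
    mul_le_mul_of_nonneg_right (pow_le_pow_left₀ (by norm_num) h2 s) (hf 0)
  linarith

lemma almostInvariant_bohr {Γ : Finset (AddChar G ℂ)} {ρ τ ε : ℝ} (hε : 0 ≤ ε) (hτ : 0 ≤ τ)
    (h : (#(bohr Γ (ρ + τ)) : ℝ) ≤ (1 + ε) * #(bohr Γ (ρ - τ))) :
    AlmostInvariant (bohr Γ ρ) (bohr Γ τ) ε := by
  intro t ht
  have h1 : ∀ y, |ind (bohr Γ ρ) (y + t) - ind (bohr Γ ρ) y|
      ≤ ind (bohr Γ (ρ + τ)) y - ind (bohr Γ (ρ - τ)) y := by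
    intro y
    have hsub : bohr Γ (ρ - τ) ⊆ bohr Γ (ρ + τ) := bohr_subset subset_rfl (by linarith)
    by_cases hy : y ∈ bohr Γ (ρ - τ)
    · have e1 : y ∈ bohr Γ ρ := bohr_subset subset_rfl (by linarith) hy
      have e2 : y + t ∈ bohr Γ ρ := by simpa using add_mem_bohr hy ht
      simp [ind, hy, e1, e2, hsub hy]
    · by_cases hy' : y ∈ bohr Γ (ρ + τ)
      · simp only [ind, hy, hy', if_true, if_false]
        split_ifs <;> norm_num
      · have e1 : y ∉ bohr Γ ρ := fun h => hy' (bohr_subset subset_rfl (by linarith) h)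
        have e2 : y + t ∉ bohr Γ ρ := fun h => hy' <| by
          simpa using add_mem_bohr h (neg_mem_bohr ht)
        simp [ind, hy, hy', e1, e2]
  have h2 : (#(bohr Γ (ρ - τ)) : ℝ) ≤ #(bohr Γ ρ) := by
    exact_mod_cast Finset.card_le_card (bohr_subset subset_rfl (by linarith))
  refine (Finset.sum_le_sum fun y _ => h1 y).trans ?_
  rw [Finset.sum_sub_distrib, sum_ind, sum_ind]
  nlinarith

/-- Every Bohr set can be shrunk by a factor at most two so as to become nearly invariant under a
smaller dilate of itself. -/
lemma exists_almostInvariant_bohr (Γ : Finset (AddChar G ℂ)) {R κ : ℝ} {n s : ℕ} (hR : 0 < R)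
    (hn : 0 < n) (hκ : 0 ≤ κ) (hκs : 4 * n * s * κ ≤ 1)
    (hcard : Fintype.card G < 2 ^ s * #(bohr Γ (R / 2))) :
    ∃ ρ, R / 2 ≤ ρ ∧ ρ ≤ R ∧ AlmostInvariant (bohr Γ ρ) (bohr Γ (κ * ρ)) (1 / n) := by
  set r : ℕ → ℝ := fun j => R / 2 + 2 * j * (κ * R) with hr
  obtain ⟨j, hj, hgrow⟩ := exists_small_growth (f := fun j => (#(bohr Γ (r j)) : ℝ)) (s := s) hn
    (fun j => by positivity) (by
      have h1 : (#(bohr Γ (r (n * s))) : ℝ) ≤ Fintype.card G := by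
        exact_mod_cast Finset.card_le_univ _
      have h2 : (Fintype.card G : ℝ) < 2 ^ s * #(bohr Γ (R / 2)) := by exact_mod_cast hcard
      have h3 : r 0 = R / 2 := by simp [hr]
      simp only [h3]
      linarith)
  have hκR : 0 ≤ κ * R := by positivity
  have hj' : (j : ℝ) + 1 ≤ n * s := by exact_mod_cast hj
  have hup : (4 * (j + 1)) * (κ * R) ≤ R := by
    calc (4 * ((j : ℝ) + 1)) * (κ * R) ≤ (4 * (n * s)) * (κ * R) :=
          mul_le_mul_of_nonneg_right (by linarith) hκR
      _ = (4 * n * s * κ) * R := by ring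
      _ ≤ R := mul_le_of_le_one_left hR.le hκs
  have hj0 : 0 ≤ (j : ℝ) * (κ * R) := by positivity
  have hρR : R / 2 + (2 * j + 1) * (κ * R) ≤ R := by linarith
  refine ⟨R / 2 + (2 * j + 1) * (κ * R), by linarith, hρR, ?_⟩
  have hinv : AlmostInvariant (bohr Γ (R / 2 + (2 * j + 1) * (κ * R))) (bohr Γ (κ * R)) (1 / n) := by
    refine almostInvariant_bohr (by positivity) hκR ?_
    have e1 : R / 2 + (2 * j + 1) * (κ * R) + κ * R = r (j + 1) := by
      simp only [hr]; push_cast; ring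
    have e2 : R / 2 + (2 * j + 1) * (κ * R) - κ * R = r j := by simp only [hr]; ring
    rw [e1, e2]
    exact hgrow
  exact fun t ht => hinv t (bohr_subset subset_rfl (mul_le_mul_of_nonneg_left hρR hκ) ht)

lemma AlmostInvariant.mono {B T T' : Finset G} {ε : ℝ} (h : AlmostInvariant B T ε) (hT : T' ⊆ T) :
    AlmostInvariant B T' ε := fun t ht => h t (hT ht)

/-- Some progression-free set has density at least `1 / c` on a nearly invariant Bohr set of rank at
most `d` and radius at least `2 ^ (-e)`. -/
def HasDenseBohr (G : Type*) [AddCommGroup G] [Fintype G] [DecidableEq G] (κ ε : ℝ) (d e : ℕ)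
    (c : ℝ) : Prop :=
  ∃ (A : Finset G) (Γ : Finset (AddChar G ℂ)) (ρ α : ℝ), ThreeAPFree (A : Set G) ∧ #Γ ≤ d ∧
    (1 / 2) ^ e ≤ ρ ∧ ρ ≤ 1 ∧ AlmostInvariant (bohr Γ ρ) (bohr Γ (κ * ρ)) ε ∧ 0 < α ∧ α⁻¹ ≤ c ∧
    ∑ x ∈ bohr Γ ρ, ind A x = α * #(bohr Γ ρ)

lemma inv_le_of_increment {α β c : ℝ} (hα : 0 < α) (hα1 : α ≤ 1) (hc : α⁻¹ ≤ c)
    (h : α + α ^ 2 / 100 ≤ β) : β⁻¹ ≤ c - 1 / 101 := by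
  have h1 : β⁻¹ ≤ (α + α ^ 2 / 100)⁻¹ := inv_anti₀ (by positivity) h
  have h2 : (α + α ^ 2 / 100)⁻¹ ≤ α⁻¹ - 1 / 101 := by
    have : (α + α ^ 2 / 100)⁻¹ = α⁻¹ - 1 / (100 + α) := by
      field_simp
      ring
    rw [this]
    have : 1 / 101 ≤ 1 / (100 + α) := one_div_le_one_div_of_le (by positivity) (by linarith)
    linarith
  linarith

lemma hasDenseBohr_of_increment {κ ε ρ α c : ℝ} {d e : ℕ} {A : Finset G}
    {Γ : Finset (AddChar G ℂ)} {φ : G → G} {x : G} (hA : ThreeAPFree (A : Set G)) (hΓ : #Γ ≤ d)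
    (hρ : (1 / 2) ^ e ≤ ρ) (hρ1 : ρ ≤ 1)
    (hinv : AlmostInvariant (bohr Γ ρ) (bohr Γ (κ * ρ)) ε) (hα : 0 < α) (hα1 : α ≤ 1)
    (hc : α⁻¹ ≤ c) (hφ : Function.Injective φ)
    (hφadd : ∀ a b : G, φ (a + b) = φ a + φ b)
    (h : (α + α ^ 2 / 100) * #(bohr Γ ρ) < ∑ t ∈ bohr Γ ρ, ind A (x + φ t)) :
    HasDenseBohr G κ ε d e (c - 1 / 101) := by
  have hρ0 : 0 ≤ ρ := le_trans (by positivity) hρ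
  have hb : (0 : ℝ) < #(bohr Γ ρ : Finset G) := by
    exact_mod_cast Finset.card_pos.2 ⟨0, zero_mem_bohr hρ0⟩
  set β := (∑ t ∈ bohr Γ ρ, ind A (x + φ t)) / #(bohr Γ ρ) with hβ
  have hαβ : α + α ^ 2 / 100 ≤ β := by rw [hβ, le_div_iff₀ hb]; exact h.le
  refine ⟨Finset.univ.filter fun t => x + φ t ∈ A, Γ, ρ, β, ?_, hΓ, hρ, hρ1, hinv,
    lt_of_lt_of_le (by positivity) hαβ, inv_le_of_increment hα hα1 hc hαβ, ?_⟩
  · intro a ha b hb c hc habc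
    rw [Finset.mem_coe, Finset.mem_filter] at ha hb hc
    refine hφ (add_left_cancel (hA ha.2 hb.2 hc.2 ?_))
    rw [add_add_add_comm, ← hφadd, habc, hφadd, add_add_add_comm]
  · rw [hβ, div_mul_cancel₀ _ hb.ne']
    simp [ind]

lemma HasDenseBohr.step {n s w d e : ℕ} {c : ℝ} (h2 : ∀ a b : G, a + a = b + b → a = b)
    (hn : 0 < n) (hs : 4 * n * s ≤ 2 ^ w) (hs' : 2 * (d + 1) * (e + 3 * w + 8) < s)
    (hcard : n * 2 ^ s ≤ Fintype.card G) (hc : 100 * c ^ 2 ≤ n)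
    (h : HasDenseBohr G ((1 / 2) ^ w) (1 / n) d e c) :
    HasDenseBohr G ((1 / 2) ^ w) (1 / n) (d + 1) (e + 3 * w + 4) (c - 1 / 101) := by
  classical
  obtain ⟨A, Γ, ρ₀, α, hA, hΓ, hρ₀, hρ₀1, hinv₀, hα, hαc, hdens⟩ := h
  have hn' : (0 : ℝ) < n := by exact_mod_cast hn
  set κ : ℝ := (1 / 2) ^ w with hκ
  have hκ0 : 0 < κ := by positivity
  have hκ1 : κ ≤ 1 := pow_le_one₀ (by norm_num) (by norm_num)
  have hκs : 4 * n * s * κ ≤ 1 := by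
    have : (4 * n * s : ℝ) ≤ 2 ^ w := by exact_mod_cast hs
    rw [hκ, one_div, inv_pow, ← div_eq_mul_inv, div_le_one (by positivity)]
    exact this
  have hκn : κ ≤ 1 / n := by
    rw [le_div_iff₀ hn']
    have : (1 : ℝ) ≤ s := by exact_mod_cast (by omega : 1 ≤ s)
    nlinarith [mul_pos hκ0 hn']
  have hρ₀0 : 0 < ρ₀ := lt_of_lt_of_le (by positivity) hρ₀
  have hbohr : ∀ Δ : Finset (AddChar G ℂ), #Δ ≤ d + 1 → ∀ r : ℝ, (1 / 2) ^ (e + 3 * w + 5) ≤ r →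
      Fintype.card G < 2 ^ s * #(bohr Δ r : Finset G) := by
    intro Δ hΔ r hr
    have h1 := card_le_two_pow_mul_card_bohr Δ hΔ hr
    have h3 : 0 < #(bohr Δ r : Finset G) :=
      Finset.card_pos.2 ⟨0, zero_mem_bohr (le_trans (by positivity) hr)⟩
    exact h1.trans_lt (Nat.mul_lt_mul_of_pos_right
      (Nat.pow_lt_pow_right (by norm_num) (by simpa [add_assoc] using hs')) h3)
  have hgood : ∀ Δ : Finset (AddChar G ℂ), #Δ ≤ d + 1 → ∀ R : ℝ, (1 / 2) ^ (e + 3 * w + 4) ≤ R →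
      ∃ ρ, R / 2 ≤ ρ ∧ ρ ≤ R ∧ AlmostInvariant (bohr Δ ρ : Finset G) (bohr Δ (κ * ρ)) (1 / n) := by
    intro Δ hΔ R hR
    refine exists_almostInvariant_bohr Δ (lt_of_lt_of_le (by positivity) hR) hn hκ0.le hκs
      (hbohr Δ hΔ _ ?_)
    rw [show e + 3 * w + 5 = (e + 3 * w + 4) + 1 from rfl, pow_succ]
    linarith
  have hscale : (1 / 2 : ℝ) ^ (e + 3 * w + 4) ≤ κ ^ 3 / 16 * ρ₀ := by
    have : (1 / 2 : ℝ) ^ (e + 3 * w + 4) = κ ^ 3 / 16 * (1 / 2) ^ e := by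
      rw [hκ, ← pow_mul, pow_add, pow_add, mul_comm 3 w]; ring
    rw [this]
    exact mul_le_mul_of_nonneg_left hρ₀ (by positivity)
  have hκ2 : κ ^ 2 ≤ κ := by nlinarith
  have hκ3 : κ ^ 3 ≤ κ ^ 2 := by nlinarith [sq_nonneg κ]
  have hx1 : κ ^ 3 * ρ₀ ≤ κ ^ 2 * ρ₀ := mul_le_mul_of_nonneg_right hκ3 hρ₀0.le
  have hx2 : κ ^ 2 * ρ₀ ≤ κ * ρ₀ := mul_le_mul_of_nonneg_right hκ2 hρ₀0.le
  have hx3 : κ * ρ₀ ≤ ρ₀ := mul_le_of_le_one_left hρ₀0.le hκ1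
  have hx4 : 0 < κ ^ 3 * ρ₀ := by positivity
  have hΓ' : #Γ ≤ d + 1 := by omega
  obtain ⟨ρ₁, hl₁, hu₁, hinv₁⟩ := hgood Γ hΓ' (κ * ρ₀) (by linarith)
  have hy1 : κ * (κ * ρ₀ / 2) ≤ κ * ρ₁ := mul_le_mul_of_nonneg_left hl₁ hκ0.le
  have hy2 : κ * ρ₁ ≤ ρ₁ := mul_le_of_le_one_left (by linarith) hκ1
  obtain ⟨ρ₂, hl₂, hu₂, hinv₂⟩ := hgood Γ hΓ' (κ * ρ₁ / 2) (by nlinarith)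
  have hz1 : κ * (κ * ρ₁ / 2 / 2) ≤ κ * ρ₂ := mul_le_mul_of_nonneg_left hl₂ hκ0.le
  have hz2 : κ * (κ * (κ * ρ₀ / 2)) ≤ κ * (κ * ρ₁) := mul_le_mul_of_nonneg_left hy1 hκ0.le
  have hr₃ : κ ^ 3 / 8 * ρ₀ ≤ κ * ρ₂ := by linarith
  have hz3 : κ * ρ₂ ≤ ρ₂ := mul_le_of_le_one_left (by nlinarith) hκ1
  have hb₀ : (bohr Γ ρ₀ : Finset G).Nonempty := ⟨0, zero_mem_bohr hρ₀0.le⟩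
  have hα1 : α ≤ 1 := by
    have : ∑ x ∈ bohr Γ ρ₀, ind A x ≤ ∑ x ∈ bohr Γ ρ₀, 1 :=
      Finset.sum_le_sum fun x _ => ind_le_one _ _
    rw [hdens, Finset.sum_const, nsmul_eq_mul] at this
    exact le_of_mul_le_mul_right (by linarith) (Nat.cast_pos.2 hb₀.card_pos)
  have hε : 1 / (n : ℝ) ≤ α ^ 2 / 100 := by
    have h1 : (α⁻¹) ^ 2 ≤ c ^ 2 := pow_le_pow_left₀ (by positivity) hαc 2
    have h3 : 1 ≤ α ^ 2 * c ^ 2 := by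
      have := mul_le_mul_of_nonneg_left h1 (sq_nonneg α)
      rwa [← mul_pow, mul_inv_cancel₀ hα.ne', one_pow] at this
    rw [div_le_iff₀ hn']
    nlinarith [sq_nonneg α]
  by_contra hcon
  have hno : ∀ (Δ : Finset (AddChar G ℂ)) (ρ : ℝ) (φ : G → G), #Δ ≤ d + 1 →
      (1 / 2) ^ (e + 3 * w + 4) ≤ ρ → ρ ≤ 1 →
      AlmostInvariant (bohr Δ ρ) (bohr Δ (κ * ρ)) (1 / n) → Function.Injective φ →
      (∀ a b : G, φ (a + b) = φ a + φ b) →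
      ∀ x, ∑ t ∈ bohr Δ ρ, ind A (x + φ t) ≤ (α + α ^ 2 / 100) * #(bohr Δ ρ) := by
    intro Δ ρ φ hΔ hρ hρ1 hinv hφ hφadd x
    by_contra hlt
    exact hcon (hasDenseBohr_of_increment hA hΔ hρ hρ1 hinv hα hα1 hαc hφ hφadd (not_le.1 hlt))
  refine density_increment (B₀ := bohr Γ ρ₀) (B₁ := bohr Γ ρ₁) (B₂ := bohr Γ ρ₂) hA hα rfl
    (by positivity) hε hb₀ ?_ ⟨0, zero_mem_bohr (by linarith)⟩ hdens
    (hinv₀.mono (bohr_subset subset_rfl hu₁))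
    (hinv₀.mono (bohr_subset subset_rfl (by linarith))) (fun x hx => neg_mem_bohr hx)
    (hinv₁.mono ?_)
    (hno Γ ρ₁ (fun t => t) hΓ' (by linarith) (by linarith) hinv₁ (fun _ _ h => h) fun _ _ => rfl)
    (hno Γ ρ₂ (fun t => t) hΓ' (by linarith) (by linarith) hinv₂ (fun _ _ h => h) fun _ _ => rfl)
    (hno Γ ρ₂ (fun t => t + t) hΓ' (by linarith) (by linarith) hinv₂ (fun a b h => h2 a b h)
      fun a b => add_add_add_comm a b a b) ?_
  · have h3 := hbohr Γ hΓ' ρ₁ (by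
      have : (1 / 2 : ℝ) ^ (e + 3 * w + 5) ≤ (1 / 2) ^ (e + 3 * w + 4) :=
        pow_le_pow_of_le_one (by norm_num) (by norm_num) (by omega)
      linarith)
    have h4 : n ≤ #(bohr Γ ρ₁ : Finset G) := by
      have : 2 ^ s * n < 2 ^ s * #(bohr Γ ρ₁ : Finset G) := by linarith
      exact (lt_of_mul_lt_mul_left this (by positivity)).le
    have h5 : (n : ℝ) ≤ #(bohr Γ ρ₁ : Finset G) := by exact_mod_cast h4
    calc (1 : ℝ) = 1 / n * n := by field_simp
      _ ≤ _ := mul_le_mul hε h5 hn'.le (by positivity)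
  · intro x hx
    obtain ⟨y, hy, rfl⟩ := Finset.mem_image.1 hx
    exact bohr_subset subset_rfl (by linarith) (add_mem_bohr hy hy)
  · intro χ
    have hΔ : #(insert χ Γ) ≤ d + 1 := (Finset.card_insert_le _ _).trans (by omega)
    obtain ⟨ρ₃, hl₃, hu₃, hinv₃⟩ := hgood (insert χ Γ) hΔ (κ * ρ₂) (by linarith)
    refine ⟨bohr (insert χ Γ) ρ₃, ⟨0, zero_mem_bohr (by linarith)⟩, fun t ht => ?_,
      hinv₂.mono (bohr_subset (Finset.subset_insert _ _) hu₃),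
      hno _ ρ₃ (fun t => t) hΔ (by linarith) (by linarith) hinv₃ (fun _ _ h => h) fun _ _ => rfl⟩
    refine (mem_bohr.1 ht χ (Finset.mem_insert_self _ _)).trans ?_
    have : κ * ρ₂ ≤ κ := mul_le_of_le_one_right hκ0.le (by linarith)
    linarith

lemma mul_card_lt_of_params {m s w : ℕ} (h2 : ∀ a b : G, a + a = b + b → a = b) (hm : 0 < m)
    (hs : 4 * (100 * m ^ 2) * s ≤ 2 ^ w)
    (hs' : 2 * (101 * m) * (101 * m * (3 * w + 4) + 4) < s)
    (hcard : 100 * m ^ 2 * 2 ^ s ≤ Fintype.card G) {A : Finset G}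
    (hA : ThreeAPFree (A : Set G)) : m * #A < Fintype.card G := by
  by_contra! hcon
  have hm' : (0 : ℝ) < m := by exact_mod_cast hm
  have hG : (0 : ℝ) < Fintype.card G := by exact_mod_cast Fintype.card_pos
  have key : ∀ k ≤ 101 * m, HasDenseBohr G ((1 / 2) ^ w) (1 / ((100 * m ^ 2 : ℕ) : ℝ)) k
      (k * (3 * w + 4)) (m - k / 101) := by
    intro k
    induction k with
    | zero =>
      intro _
      have huniv : ∀ r : ℝ, (bohr ∅ r : Finset G) = Finset.univ := fun r => by
        ext x; simp [mem_bohr]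
      have hcon' : (Fintype.card G : ℝ) ≤ m * #A := by exact_mod_cast hcon
      have hA0 : (0 : ℝ) < #A := by
        by_contra hc; push Not at hc; nlinarith
      refine ⟨A, ∅, 1, #A / Fintype.card G, hA, by simp, by simp, le_rfl, ?_, by positivity, ?_, ?_⟩
      · intro t _
        simp only [huniv]
        simp only [ind, Finset.mem_univ, if_true, sub_self, abs_zero, Finset.sum_const_zero]
        positivity
      · rw [inv_div, div_le_iff₀ hA0]
        simpa using hcon'
      · rw [huniv, Finset.card_univ, div_mul_cancel₀ _ hG.ne', sum_ind]
    | succ k ih =>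
      intro hk
      have h := (ih (by omega)).step h2 (by positivity) hs ?_ hcard ?_
      · convert h using 1
        · ring
        · push_cast; ring
      · refine lt_of_le_of_lt ?_ hs'
        refine Nat.mul_le_mul (by omega) ?_
        have := Nat.mul_le_mul_right (3 * w + 4) hk
        linarith
      · have h1 : (0 : ℝ) ≤ m - k / 101 := by
          obtain ⟨_, _, _, α, _, _, _, _, _, hα, hαc, _⟩ := ih (by omega)
          exact le_trans (by positivity) hαc
        have h3 : (0 : ℝ) ≤ k / 101 := by positivity
        push_cast
        nlinarith
  obtain ⟨_, _, _, α, _, _, _, _, _, hα, hαc, _⟩ := key (101 * m) le_rfl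
  have : (m : ℝ) - ((101 * m : ℕ) : ℝ) / 101 = 0 := by push_cast; ring
  rw [this] at hαc
  exact absurd (inv_pos.2 hα) (not_lt.2 hαc)

/-- A progression-free subset of a finite abelian group without `2`-torsion has density less than
`1 / m` once the group has order at least `exp (O(m ^ 2 log m))`. -/
theorem mul_card_lt_card {m l : ℕ} (h2 : ∀ a b : G, a + a = b + b → a = b) (hm : 0 < m)
    (hml : m ≤ 2 ^ l) (hcard : 2 ^ (2200000 * m ^ 2 * (l + 1)) ≤ Fintype.card G) {A : Finset G}
    (hA : ThreeAPFree (A : Set G)) : m * #A < Fintype.card G := by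
  have hl : l + 1 ≤ 2 ^ l := Nat.lt_two_pow_self
  have hm2 : m ^ 2 ≤ 2 ^ (2 * l) := by rw [mul_comm, pow_mul]; exact Nat.pow_le_pow_left hml 2
  have hm1 : 1 ≤ m ^ 2 := Nat.one_le_pow _ _ hm
  have hmm : m ≤ m ^ 2 := by nlinarith
  have hlm : l ≤ l * m ^ 2 := Nat.le_mul_of_pos_right _ hm1
  have hs : 20402 * m ^ 2 * (15 * l + 105) ≤ 2142210 * (m ^ 2 * (l + 1)) := by nlinarith
  refine mul_card_lt_of_params (s := 20402 * m ^ 2 * (15 * l + 105)) (w := 5 * l + 32) h2 hm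
    ?_ ?_ ?_ hA
  · calc 4 * (100 * m ^ 2) * (20402 * m ^ 2 * (15 * l + 105))
        ≤ 4 * (100 * 2 ^ (2 * l)) * (2142210 * (2 ^ (2 * l) * 2 ^ l)) :=
          Nat.mul_le_mul (by omega) (hs.trans (Nat.mul_le_mul_left _ (Nat.mul_le_mul hm2 hl)))
      _ = 856884000 * 2 ^ (5 * l) := by ring
      _ ≤ 2 ^ 32 * 2 ^ (5 * l) := Nat.mul_le_mul_right _ (by norm_num)
      _ = 2 ^ (5 * l + 32) := by ring
  · nlinarith
  · refine le_trans ?_ hcard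
    calc 100 * m ^ 2 * 2 ^ (20402 * m ^ 2 * (15 * l + 105))
        ≤ (2 ^ 7 * 2 ^ (2 * l)) * 2 ^ (2142210 * (m ^ 2 * (l + 1))) :=
          Nat.mul_le_mul (Nat.mul_le_mul (by norm_num) hm2)
            (Nat.pow_le_pow_right (by norm_num) hs)
      _ = 2 ^ (7 + 2 * l + 2142210 * (m ^ 2 * (l + 1))) := by rw [pow_add, pow_add]
      _ ≤ _ := Nat.pow_le_pow_right (by norm_num) (by nlinarith)

lemma zmod_eq_of_add_self_eq {N : ℕ} {a b : ZMod (2 * N + 1)} (h : a + a = b + b) : a = b := by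
  have h0 : ((2 * N + 1 : ℕ) : ZMod (2 * N + 1)) = 0 := ZMod.natCast_self _
  push_cast at h0
  linear_combination (N + 1 : ZMod (2 * N + 1)) * h - (a - b) * h0

lemma card_mul_lt_of_no_progression {N m l : ℕ} {S : Finset ℕ} (hS : S ⊆ Finset.Icc 1 N)
    (hfree : ¬ ∃ x d : ℕ, d ≠ 0 ∧ x ∈ S ∧ x + d ∈ S ∧ x + 2 * d ∈ S) (hm : 0 < m)
    (hml : m ≤ 2 ^ l) (hN : 2 ^ (2200000 * m ^ 2 * (l + 1)) ≤ 2 * N + 1) :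
    m * #S < 2 * N + 1 := by
  have hle : ∀ x ∈ S, x ≤ N := fun x hx => (Finset.mem_Icc.1 (hS hx)).2
  have hinj : ∀ x y : ℕ, x < 2 * N + 1 → y < 2 * N + 1 →
      (x : ZMod (2 * N + 1)) = y → x = y := by
    intro x y hx hy h
    rw [ZMod.natCast_eq_natCast_iff] at h
    exact Nat.ModEq.eq_of_lt_of_lt h hx hy
  have hcard : #(S.image fun n : ℕ => (n : ZMod (2 * N + 1))) = #S :=
    Finset.card_image_of_injOn fun x hx y hy h =>
      hinj x y (by have := hle x hx; omega) (by have := hle y hy; omega) h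
  have hA : ThreeAPFree
      ((S.image fun n : ℕ => (n : ZMod (2 * N + 1)) : Finset _) : Set (ZMod (2 * N + 1))) := by
    intro a ha b hb c hc habc
    obtain ⟨x, hx, rfl⟩ := Finset.mem_image.1 (Finset.mem_coe.1 ha)
    obtain ⟨y, hy, rfl⟩ := Finset.mem_image.1 (Finset.mem_coe.1 hb)
    obtain ⟨z, hz, rfl⟩ := Finset.mem_image.1 (Finset.mem_coe.1 hc)
    have hxN := hle x hx
    have hyN := hle y hy
    have hzN := hle z hz
    have hxyz : x + z = y + y :=
      hinj _ _ (by omega) (by omega) (by push_cast; exact habc)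
    rcases lt_trichotomy x y with h | h | h
    · refine absurd ⟨x, y - x, by omega, hx, ?_, ?_⟩ hfree
      · rwa [show x + (y - x) = y by omega]
      · rwa [show x + 2 * (y - x) = z by omega]
    · rw [h]
    · refine absurd ⟨z, y - z, by omega, hz, ?_, ?_⟩ hfree
      · rwa [show z + (y - z) = y by omega]
      · rwa [show z + 2 * (y - z) = x by omega]
  have := mul_card_lt_card (fun a b => zmod_eq_of_add_self_eq) hm hml
    (by rwa [ZMod.card]) hA
  rwa [hcard, ZMod.card] at this

end Bourgain

/-- Bourgain's theorem: progression-free subsets of `{1,...,N}` have size at most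
`C · N · √(log log N / log N)`. -/
theorem bourgain :
    ∃ C : ℝ, 0 < C ∧ ∃ N₀ : ℕ, ∀ N : ℕ, N₀ < N →
      ∀ S : Finset ℕ, S ⊆ Finset.Icc 1 N →
        (¬ ∃ x d : ℕ, d ≠ 0 ∧ x ∈ S ∧ x + d ∈ S ∧ x + 2 * d ∈ S) →
        (S.card : ℝ) ≤ C * (N : ℝ) * Real.sqrt (Real.log (Real.log N) / Real.log N) := by
  have hlog : Filter.Tendsto (fun N : ℕ => Real.log N) Filter.atTop Filter.atTop :=
    Real.tendsto_log_atTop.comp tendsto_natCast_atTop_atTop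
  have hev : ∀ᶠ N : ℕ in Filter.atTop, 1 ≤ Real.log (Real.log N) ∧
      Real.log (Real.log N) ≤ 1 / 9000000 * Real.log N ∧ 0 < Real.log N := by
    have h1 := (Real.tendsto_log_atTop.comp hlog).eventually_ge_atTop 1
    have h2 := hlog.eventually (Real.isLittleO_log_id_atTop.bound
      (by norm_num : (0 : ℝ) < 1 / 9000000))
    filter_upwards [h1, h2, hlog.eventually_gt_atTop 0] with N h1 h2 h3
    refine ⟨h1, ?_, h3⟩
    simp only [id, Real.norm_eq_abs] at h2
    rw [abs_of_pos h3] at h2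
    exact (le_abs_self _).trans h2
  obtain ⟨N₀, hN₀⟩ := Filter.eventually_atTop.1 hev
  refine ⟨18000, by norm_num, N₀, fun N hN S hS hfree => ?_⟩
  obtain ⟨hLL, hLLL, hL⟩ := hN₀ N hN.le
  set L := Real.log N with hLdef
  set K := Real.log L with hKdef
  have hK : 0 < K := by linarith
  have hN1 : (1 : ℝ) ≤ N := by
    have : N ≠ 0 := by rintro rfl; simp [hLdef] at hL
    exact_mod_cast Nat.one_le_iff_ne_zero.2 this
  set T := Real.sqrt (L / K) with hT
  have hTsq : T ^ 2 = L / K := Real.sq_sqrt (by positivity)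
  have hT3000 : 3000 ≤ T := by
    refine Real.le_sqrt_of_sq_le ?_
    rw [le_div_iff₀ hK]; linarith
  have hTinv : Real.sqrt (K / L) = T⁻¹ := by rw [hT, ← Real.sqrt_inv, inv_div]
  set m := ⌊T / 3000⌋₊ with hm
  have hm1 : 1 ≤ m := Nat.le_floor (by rw [Nat.cast_one, le_div_iff₀ (by norm_num)]; linarith)
  have hm1' : (1 : ℝ) ≤ m := by exact_mod_cast hm1
  have hmT : (m : ℝ) ≤ T / 3000 := Nat.floor_le (by positivity)
  have hTm : T / 6000 ≤ m := by
    have := Nat.lt_floor_add_one (T / 3000)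
    linarith
  have hmsq : (m : ℝ) ^ 2 ≤ L / K / 9000000 := by
    calc (m : ℝ) ^ 2 ≤ (T / 3000) ^ 2 := pow_le_pow_left₀ (by positivity) hmT 2
      _ = L / K / 9000000 := by rw [div_pow, hTsq]; norm_num
  set l := ⌈K⌉₊ with hl
  have hKl : K ≤ l := Nat.le_ceil K
  have hlK : (l : ℝ) < K + 1 := Nat.ceil_lt_add_one hK.le
  have hlog2 : 1 / 2 ≤ Real.log 2 := by linarith [Real.log_two_gt_d9]
  have hlog2' : Real.log 2 ≤ 1 := by linarith [Real.log_two_lt_d9]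
  have hml : m ≤ 2 ^ l := by
    have h1 : (m : ℝ) ^ 2 ≤ L := by
      refine hmsq.trans ?_
      rw [div_div, div_le_iff₀ (by positivity)]
      nlinarith
    have h2 : 2 * Real.log m ≤ K := by
      have := Real.log_le_log (by positivity) h1
      rwa [Real.log_pow] at this
    have h3 : Real.log m ≤ Real.log (2 ^ l) := by
      rw [Real.log_pow]
      nlinarith
    have h4 := (Real.log_le_log_iff (by positivity) (by positivity)).1 h3
    exact_mod_cast h4
  have hbig : 2 ^ (2200000 * m ^ 2 * (l + 1)) ≤ 2 * N + 1 := by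
    have h1 : Real.log (2 ^ (2200000 * m ^ 2 * (l + 1))) ≤ L := by
      rw [Real.log_pow]
      push_cast
      calc 2200000 * (m : ℝ) ^ 2 * (l + 1) * Real.log 2
          ≤ 2200000 * (m : ℝ) ^ 2 * (l + 1) := mul_le_of_le_one_right (by positivity) hlog2'
        _ ≤ 2200000 * (L / K / 9000000) * (3 * K) := by
            refine mul_le_mul ?_ (by linarith) (by positivity) (by positivity)
            linarith
        _ = 6600000 / 9000000 * L := by field_simp; norm_num
        _ ≤ L := by linarith
    have h2 := (Real.log_le_log_iff (by positivity) (by positivity)).1 h1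
    have h3 : 2 ^ (2200000 * m ^ 2 * (l + 1)) ≤ N := by exact_mod_cast h2
    omega
  have hlt := Bourgain.card_mul_lt_of_no_progression hS hfree hm1 hml hbig
  have hlt' : (m : ℝ) * S.card ≤ 3 * N := by
    have : (m : ℝ) * S.card < 2 * N + 1 := by exact_mod_cast hlt
    linarith
  have hT0 : 0 < T := by linarith
  rw [hTinv, ← div_eq_mul_inv, le_div_iff₀ hT0]
  have : T / 6000 * S.card ≤ m * S.card := mul_le_mul_of_nonneg_right hTm (Nat.cast_nonneg _)
  linarith
end

section
/- For every prime p ≥ 3 there exists a constant κ_p > 0 such that for all n ≥ 1, every subset S ⊆ 𝔽_p^n containing no three-term arithmetic progression satisfies |S| ≤ 2^{−κ_p · n^{1/9}} · p^n. -/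
open Finset

theorem Submodule.exists_finrank_le_card_support {K ι : Type*} [Field K] [DecidableEq K] [Fintype ι]
    (V : Submodule K (ι → K)) :
    ∃ v ∈ V, Module.finrank K V ≤ #{x | v x ≠ 0} := by
  suffices H : ∀ k ≤ Module.finrank K V, ∃ v ∈ V, k ≤ #{x | v x ≠ 0} from H _ le_rfl
  intro k
  induction k with
  | zero => exact fun _ => ⟨0, V.zero_mem, Nat.zero_le _⟩
  | succ k ih =>
    intro hk
    obtain ⟨v, hv, hkv⟩ := ih (by omega)
    rcases hkv.lt_or_eq with hlt | heq
    · exact ⟨v, hv, hlt⟩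
    let φ : V →ₗ[K] ({x // v x ≠ 0} → K) := LinearMap.funLeft K K Subtype.val ∘ₗ V.subtype
    have hφ : LinearMap.ker φ ≠ ⊥ := by
      apply LinearMap.ker_ne_bot_of_finrank_lt
      rw [Module.finrank_fintype_fun_eq_card, Fintype.card_subtype]
      omega
    obtain ⟨w, hw, hw0⟩ := Submodule.exists_mem_ne_zero_of_ne_bot hφ
    have hwv : ∀ x, v x ≠ 0 → (w : ι → K) x = 0 := fun x hx =>
      congrFun (LinearMap.mem_ker.1 hw) ⟨x, hx⟩
    obtain ⟨x, hx⟩ : ∃ x, (w : ι → K) x ≠ 0 := by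
      by_contra! h
      exact hw0 (Subtype.ext (funext h))
    refine ⟨v + w, V.add_mem hv w.2, ?_⟩
    rw [heq]
    refine Finset.card_lt_card (Finset.ssubset_iff_of_subset ?_ |>.2 ⟨x, ?_, ?_⟩)
    · intro y hy
      simp only [mem_filter, mem_univ, true_and] at hy ⊢
      simpa [hwv y hy] using hy
    · have : v x = 0 := by_contra fun h => hx (hwv x h)
      simpa [this] using hx
    · simpa using fun h => hx (hwv x h)

theorem card_le_of_diagonal_eq_sum_slices {K ι A B C : Type*} [Field K] [Fintype ι] [DecidableEq ι]
    [Fintype A] [Fintype B] [Fintype C]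
    (f : A → ι → K) (f' : A → ι → ι → K) (g : B → ι → K) (g' : B → ι → ι → K)
    (h : C → ι → K) (h' : C → ι → ι → K)
    (H : ∀ x y z, ∑ a, f a x * f' a y z + ∑ b, g b y * g' b x z + ∑ c, h c z * h' c x y =
      if x = y ∧ y = z then 1 else 0) :
    Fintype.card ι ≤ Fintype.card A + Fintype.card B + Fintype.card C := by
  classical
  let φ : (ι → K) →ₗ[K] (A → K) := Matrix.mulVecLin (Matrix.of f)
  obtain ⟨v, hv, hcard⟩ := (LinearMap.ker φ).exists_finrank_le_card_support
  have hrank := LinearMap.finrank_range_add_finrank_ker φ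
  have hle := (LinearMap.range φ).finrank_le
  simp only [Module.finrank_fintype_fun_eq_card] at hrank hle
  have hv' : ∀ a, ∑ x, f a x * v x = 0 := fun a => congrFun (LinearMap.mem_ker.1 hv) a
  let P : Matrix ι (B ⊕ C) K := fun y => Sum.elim (fun b => g b y) fun c => ∑ x, v x * h' c x y
  let Q : Matrix (B ⊕ C) ι K := fun s z => s.elim (fun b => ∑ x, v x * g' b x z) fun c => h c z
  have hPQ : Matrix.diagonal v = P * Q := by
    ext y z
    have hA : ∑ x, v x * ∑ a, f a x * f' a y z = 0 := by
      simp_rw [mul_sum]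
      rw [sum_comm]
      refine sum_eq_zero fun a _ => ?_
      rw [← zero_mul (f' a y z), ← hv' a, sum_mul]
      exact sum_congr rfl fun x _ => by ring
    have hB : ∑ x, v x * ∑ b, g b y * g' b x z = ∑ b, g b y * ∑ x, v x * g' b x z := by
      simp_rw [mul_sum]
      rw [sum_comm]
      exact sum_congr rfl fun b _ => sum_congr rfl fun x _ => by ring
    have hC : ∑ x, v x * ∑ c, h c z * h' c x y = ∑ c, (∑ x, v x * h' c x y) * h c z := by
      simp_rw [mul_sum, sum_mul]
      rw [sum_comm]
      exact sum_congr rfl fun b _ => sum_congr rfl fun x _ => by ring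
    have hsum : ∑ x, v x * (if x = y ∧ y = z then (1 : K) else 0) = Matrix.diagonal v y z := by
      by_cases hyz : y = z <;> simp [hyz]
    rw [← hsum, Matrix.mul_apply, Fintype.sum_sum_type]
    simp only [← H, mul_add, sum_add_distrib, hA, hB, hC, zero_add, P, Q, Sum.elim_inl, Sum.elim_inr]
  have hdiag := (Matrix.rank_mul_le_left P Q).trans P.rank_le_card_width
  rw [← hPQ, Matrix.rank_diagonal, Fintype.card_sum, Fintype.card_subtype] at hdiag
  omega

theorem sum_mul_eq_sum_mul_sum_fiber {α β K : Type*} [CommSemiring K] [DecidableEq β]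
    {s : Finset α} {t : Finset β} {k : α → β} (hk : ∀ i ∈ s, k i ∈ t) (u : β → K) (w : α → K) :
    ∑ i ∈ s, u (k i) * w i = ∑ b : t, u b * ∑ i ∈ s with k i = b, w i := by
  rw [Finset.sum_coe_sort t fun b => u b * ∑ i ∈ s with k i = b, w i,
    ← sum_fiberwise_of_maps_to hk]
  refine sum_congr rfl fun b _ => ?_
  rw [mul_sum]
  refine sum_congr rfl fun i hi => ?_
  rw [(mem_filter.1 hi).2]

/-- Exponent vectors in `[0, p)^n` whose total degree is at most a third of the maximum. -/
def lowDegreeExponents (p n : ℕ) : Finset (Fin n → ℕ) :=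
  {a ∈ Fintype.piFinset fun _ : Fin n => range p | 3 * ∑ i, a i ≤ n * (p - 1)}

theorem one_sub_pow_eq_sum_monomials {K : Type*} [CommRing K] {m : ℕ} (hm : m ≠ 0) :
    ∃ (T : Finset (Fin 3 → ℕ)) (c : (Fin 3 → ℕ) → K), (∀ t ∈ T, t 0 + t 1 + t 2 ≤ m) ∧
      ∀ x y z : K, 1 - (x + z - (y + y)) ^ m = ∑ t ∈ T, c t * (x ^ t 0 * y ^ t 1 * z ^ t 2) := by
  classical
  have h0 : (0 : Fin 3 → ℕ) ∉ univ.piAntidiag m := by simp [mem_piAntidiag, hm.symm]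
  refine ⟨insert 0 (univ.piAntidiag m),
    fun t => if t = 0 then 1 else -((Nat.multinomial univ t : K) * (-2) ^ t 1), ?_, ?_⟩
  · intro t ht
    rcases mem_insert.1 ht with rfl | ht
    · simp
    · rw [mem_piAntidiag, Fin.sum_univ_three] at ht
      exact ht.1.le
  · intro x y z
    have key : (x + z - (y + y)) ^ m = (∑ i, ![x, -2 * y, z] i) ^ m := by
      rw [Fin.sum_univ_three]
      simp only [Matrix.cons_val]
      ring
    rw [sum_insert h0, key, sum_pow_eq_sum_piAntidiag, sub_eq_add_neg, ← sum_neg_distrib]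
    congr 1
    · simp
    · refine sum_congr rfl fun t ht => ?_
      beta_reduce
      rw [if_neg (ne_of_mem_of_not_mem ht h0), Fin.prod_univ_three]
      simp only [Matrix.cons_val]
      ring

theorem card_le_three_mul_card_lowDegreeExponents {p : ℕ} (hp : p.Prime) {n : ℕ}
    {S : Finset (Fin n → ZMod p)}
    (hS : ∀ x ∈ S, ∀ y ∈ S, ∀ z ∈ S, x + z = y + y → x = y ∧ y = z) :
    #S ≤ 3 * #(lowDegreeExponents p n) := by
  classical
  have : Fact p.Prime := ⟨hp⟩
  have hp1 : p - 1 ≠ 0 := by have := hp.two_le; omega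
  obtain ⟨T, c, hT, hc⟩ := one_sub_pow_eq_sum_monomials (K := ZMod p) hp1
  let Ω := Fintype.piFinset fun _ : Fin n => T
  let mon (j : Fin 3) (τ : Fin n → Fin 3 → ℕ) (x : Fin n → ZMod p) := ∏ i, x i ^ τ i j
  let C (τ : Fin n → Fin 3 → ℕ) := ∏ i, c (τ i)
  have hexp (x y z : Fin n → ZMod p) : ∏ i, (1 - (x i + z i - (y i + y i)) ^ (p - 1)) =
      ∑ τ ∈ Ω, C τ * (mon 0 τ x * mon 1 τ y * mon 2 τ z) := by
    simp_rw [hc, prod_univ_sum, mon, C, ← prod_mul_distrib, Ω]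
  have hind (x y z : S) :
      ∏ i, (1 - (x.1 i + z.1 i - (y.1 i + y.1 i)) ^ (p - 1)) =
        if x = y ∧ y = z then 1 else 0 := by
    split_ifs with h
    · obtain ⟨rfl, rfl⟩ := h
      simp [hp1]
    · have hne : x.1 + z.1 ≠ y.1 + y.1 := fun he => h <| by
        simpa only [Subtype.ext_iff] using hS _ x.2 _ y.2 _ z.2 he
      obtain ⟨i, hi⟩ := Function.ne_iff.1 hne
      refine prod_eq_zero (mem_univ i) ?_
      exact sub_eq_zero.2 (ZMod.pow_card_sub_one_eq_one (sub_ne_zero.2 hi)).symm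
  have hlow (τ : Fin n → Fin 3 → ℕ) (hτ : τ ∈ Ω) : ∃ j, 3 * ∑ i, τ i j ≤ n * (p - 1) := by
    have htot : ∑ i, (τ i 0 + τ i 1 + τ i 2) ≤ n * (p - 1) := by
      simpa using sum_le_card_nsmul univ _ _ fun i _ => hT _ (Fintype.mem_piFinset.1 hτ i)
    simp only [sum_add_distrib] at htot
    by_contra! h
    have h0 := h 0
    have h1 := h 1
    have h2 := h 2
    omega
  choose! σ hσ using hlow
  have hmem (j : Fin 3) : ∀ τ ∈ {τ ∈ Ω | σ τ = j}, (fun i => τ i j) ∈ lowDegreeExponents p n := by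
    intro τ hτ
    obtain ⟨hτΩ, rfl⟩ := mem_filter.1 hτ
    refine mem_filter.2 ⟨Fintype.mem_piFinset.2 fun i => mem_range.2 ?_, hσ τ hτΩ⟩
    have h := hT _ (Fintype.mem_piFinset.1 hτΩ i)
    have hj : ∀ j, τ i j ≤ τ i 0 + τ i 1 + τ i 2 := by
      intro j
      fin_cases j <;> simp <;> omega
    have := hj (σ τ)
    omega
  let E (a : lowDegreeExponents p n) (x : S) := ∏ i, x.1 i ^ a.1 i
  let R (j k l : Fin 3) (a : lowDegreeExponents p n) (x y : S) :=
    ∑ τ ∈ {τ ∈ Ω | σ τ = j} with (fun i => τ i j) = a, C τ * mon k τ x * mon l τ y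
  have hslice (j k l : Fin 3) (x y z : S) :
      ∑ τ ∈ Ω with σ τ = j, mon j τ x * (C τ * mon k τ y * mon l τ z) =
        ∑ a, E a x * R j k l a y z :=
    sum_mul_eq_sum_mul_sum_fiber (hmem j) (fun a => ∏ i, x.1 i ^ a i) _
  have := card_le_of_diagonal_eq_sum_slices (K := ZMod p) (ι := S)
    E (R 0 1 2) E (R 1 0 2) E (R 2 0 1) fun x y z => by
      rw [← hind, hexp, ← sum_fiberwise Ω σ, Fin.sum_univ_three, ← hslice, ← hslice, ← hslice]
      congr 1
      · congr 1 <;> exact sum_congr rfl fun τ _ => by ring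
      · exact sum_congr rfl fun τ _ => by ring
  simp only [Fintype.card_coe] at this
  omega

theorem card_lowDegreeExponents_mul_pow_le {p n : ℕ} {s : ℝ} (hs0 : 0 ≤ s) (hs1 : s ≤ 1) :
    #(lowDegreeExponents p n) * (s ^ (p - 1)) ^ n ≤ (∑ k ∈ range p, s ^ (3 * k)) ^ n := by
  calc #(lowDegreeExponents p n) * (s ^ (p - 1)) ^ n
      = ∑ _a ∈ lowDegreeExponents p n, s ^ (n * (p - 1)) := by
        rw [sum_const, nsmul_eq_mul, ← pow_mul, mul_comm n]
    _ ≤ ∑ a ∈ lowDegreeExponents p n, ∏ i, s ^ (3 * a i) := by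
        refine sum_le_sum fun a ha => ?_
        rw [prod_pow_eq_pow_sum, ← mul_sum]
        exact pow_le_pow_of_le_one hs0 hs1 (mem_filter.1 ha).2
    _ ≤ ∑ a ∈ Fintype.piFinset fun _ : Fin n => range p, ∏ i, s ^ (3 * a i) :=
        sum_le_sum_of_subset_of_nonneg (filter_subset _ _) fun _ _ _ => by positivity
    _ = (∑ k ∈ range p, s ^ (3 * k)) ^ n := by
        rw [← prod_univ_sum (fun _ => range p) fun _ k => s ^ (3 * k), prod_const, card_univ,
          Fintype.card_fin]

theorem exists_sum_pow_lt_mul_pow {p : ℕ} (hp : 2 ≤ p) :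
    ∃ s : ℝ, 0 < s ∧ s < 1 ∧ ∑ k ∈ range p, s ^ (3 * k) < p * s ^ (p - 1) := by
  have hderiv : HasDerivAt (fun s : ℝ => ∑ k ∈ range p, s ^ (3 * k) - p * s ^ (p - 1))
      (∑ k ∈ range p, ((3 * k : ℕ) : ℝ) * 1 ^ (3 * k - 1) -
        p * (((p - 1 : ℕ) : ℝ) * 1 ^ (p - 1 - 1))) 1 :=
    (HasDerivAt.fun_sum fun k _ => hasDerivAt_pow (3 * k) (1 : ℝ)).sub
      ((hasDerivAt_pow (p - 1) (1 : ℝ)).const_mul _)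
  have hpos : 0 < ∑ k ∈ range p, ((3 * k : ℕ) : ℝ) * 1 ^ (3 * k - 1) -
        p * (((p - 1 : ℕ) : ℝ) * 1 ^ (p - 1 - 1)) := by
    have hgauss := sum_range_id_mul_two p
    have hp' : 0 < p * (p - 1) := Nat.mul_pos (by omega) (by omega)
    simp only [one_pow, mul_one, ← Nat.cast_sum, ← Nat.cast_mul, sub_pos, Nat.cast_lt]
    rw [← mul_sum]
    omega
  have hev := (hasDerivAt_iff_tendsto_slope_left_right.1 hderiv).1.eventually (lt_mem_nhds hpos)
  obtain ⟨s, hs, hs01⟩ := (hev.and (Ioo_mem_nhdsLT (zero_lt_one' ℝ))).exists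
  refine ⟨s, hs01.1, hs01.2, ?_⟩
  rw [slope_def_field] at hs
  have hneg := (div_pos_iff.1 hs).resolve_left fun h => by linarith [h.2, hs01.2]
  simpa using hneg.1

theorem exists_card_le_three_mul_pow {p : ℕ} (hp : p.Prime) :
    ∃ θ : ℝ, 0 < θ ∧ θ < 1 ∧ ∀ (n : ℕ) (S : Finset (Fin n → ZMod p)),
      (∀ x ∈ S, ∀ y ∈ S, ∀ z ∈ S, x + z = y + y → x = y ∧ y = z) →
        (#S : ℝ) ≤ 3 * θ ^ n * (p : ℝ) ^ n := by
  obtain ⟨s, hs0, hs1, hs⟩ := exists_sum_pow_lt_mul_pow hp.two_le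
  have hp0 : (0 : ℝ) < p := mod_cast hp.pos
  have hnum : 0 < ∑ k ∈ range p, s ^ (3 * k) :=
    sum_pos (fun k _ => by positivity) ⟨0, mem_range.2 hp.pos⟩
  refine ⟨(∑ k ∈ range p, s ^ (3 * k)) / (p * s ^ (p - 1)), by positivity,
    (div_lt_one (by positivity)).2 hs, fun n S hS => ?_⟩
  have h1 : (#S : ℝ) ≤ 3 * #(lowDegreeExponents p n) :=
    mod_cast card_le_three_mul_card_lowDegreeExponents hp hS
  have h2 := card_lowDegreeExponents_mul_pow_le (p := p) (n := n) hs0.le hs1.le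
  rw [← le_div_iff₀ (by positivity)] at h2
  calc (#S : ℝ) ≤ 3 * ((∑ k ∈ range p, s ^ (3 * k)) ^ n / (s ^ (p - 1)) ^ n) := by linarith
    _ = _ := by
      rw [div_pow, mul_pow]
      field_simp

theorem card_add_one_le_pow {p n : ℕ} (hp : 1 < p) (hn : 1 ≤ n) {S : Finset (Fin n → ZMod p)}
    (hS : ∀ x ∈ S, ∀ y ∈ S, ∀ z ∈ S, x + z = y + y → x = y ∧ y = z) :
    #S + 1 ≤ p ^ n := by
  have : NeZero p := ⟨by omega⟩
  have : Fact (1 < p) := ⟨hp⟩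
  have hne : S ≠ univ := by
    rintro rfl
    have h := (hS 1 (mem_univ _) 0 (mem_univ _) (-1) (mem_univ _) (by simp)).1
    exact one_ne_zero (congrFun h ⟨0, hn⟩)
  have hlt := card_lt_card (ssubset_univ_iff.2 hne)
  simpa [ZMod.card] using hlt

theorem exists_min_three_mul_pow_le_pow {p θ : ℝ} (hp : 1 ≤ p) (hθ0 : 0 < θ) (hθ1 : θ < 1) :
    ∃ q : ℝ, 0 < q ∧ q < 1 ∧ ∀ n : ℕ, min (3 * θ ^ n) (1 - (p ^ n)⁻¹) ≤ q ^ n := by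
  have hφ0 : 0 < √θ := Real.sqrt_pos.2 hθ0
  have hφ1 : √θ < 1 := (Real.sqrt_lt' one_pos).2 (by simpa using hθ1)
  obtain ⟨N, hN⟩ := exists_pow_lt_of_lt_one (show (0 : ℝ) < 1 / 3 by norm_num) hφ1
  have hpN : 0 < (p ^ N)⁻¹ := by positivity
  have hpN1 : (p ^ N)⁻¹ ≤ 1 := inv_le_one_of_one_le₀ (one_le_pow₀ hp)
  let δ : ℝ := (p ^ N)⁻¹ / (N + 1)
  have hδ : 0 < δ := by positivity
  have hδ1 : δ ≤ 1 := div_le_one_of_le₀ (by linarith [N.cast_nonneg (α := ℝ)]) (by positivity)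
  have hNδ : N * δ ≤ (p ^ N)⁻¹ := by
    have : (N + 1) * δ = (p ^ N)⁻¹ := mul_div_cancel₀ _ (by positivity)
    linarith
  refine ⟨max (√θ) (1 - δ), lt_max_of_lt_left hφ0, max_lt hφ1 (by linarith), fun n => ?_⟩
  rcases le_total n N with hn | hn
  · refine (min_le_right _ _).trans ?_
    calc 1 - (p ^ n)⁻¹ ≤ 1 - (p ^ N)⁻¹ := by gcongr
      _ ≤ 1 + N * -δ := by linarith
      _ ≤ (1 + -δ) ^ N := one_add_mul_le_pow (by linarith) N
      _ ≤ (1 + -δ) ^ n := pow_le_pow_of_le_one (by linarith) (by linarith) hn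
      _ ≤ _ := by
        gcongr
        · linarith
        · exact le_max_right _ _
  · refine (min_le_left _ _).trans ?_
    have hn' : √θ ^ n ≤ 1 / 3 := (pow_le_pow_of_le_one hφ0.le hφ1.le hn).trans hN.le
    calc 3 * θ ^ n = 3 * √θ ^ n * √θ ^ n := by
          rw [mul_assoc, ← mul_pow, Real.mul_self_sqrt hθ0.le]
      _ ≤ 1 * √θ ^ n := by gcongr; linarith
      _ ≤ _ := by
        rw [one_mul]
        gcongr
        exact le_max_left _ _

/-- Kelley–Meka finite-field bound: for every prime `p ≥ 3`, progression-free subsets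
of `𝔽_p^n` have size at most `2^{−κ_p n^{1/9}} · p^n`. -/
theorem kelley_meka_finite_field (p : ℕ) (hp : p.Prime) (hp3 : 3 ≤ p) :
    ∃ κ : ℝ, 0 < κ ∧
      ∀ n : ℕ, 1 ≤ n →
        ∀ S : Finset (Fin n → ZMod p),
          (∀ x ∈ S, ∀ y ∈ S, ∀ z ∈ S, x + z = y + y → x = y ∧ y = z) →
          (S.card : ℝ) ≤ (2 : ℝ) ^ (-(κ * (n : ℝ) ^ ((1 : ℝ) / 9))) * (p : ℝ) ^ n := by
  obtain ⟨θ, hθ0, hθ1, hθ⟩ := exists_card_le_three_mul_pow hp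
  have hp1 : (1 : ℝ) ≤ p := mod_cast hp.one_le
  obtain ⟨q, hq0, hq1, hq⟩ := exists_min_three_mul_pow_le_pow hp1 hθ0 hθ1
  have hlog : Real.logb 2 q < 0 := Real.logb_neg one_lt_two hq0 hq1
  refine ⟨-Real.logb 2 q, neg_pos.2 hlog, fun n hn S hS => ?_⟩
  have hpn : (0 : ℝ) < (p : ℝ) ^ n := by positivity
  have hS1 : (S.card : ℝ) / (p : ℝ) ^ n ≤ 3 * θ ^ n := (div_le_iff₀ hpn).2 (hθ n S hS)
  have hS2 : (S.card : ℝ) / (p : ℝ) ^ n ≤ 1 - ((p : ℝ) ^ n)⁻¹ := by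
    have h : (S.card : ℝ) + 1 ≤ (p : ℝ) ^ n := mod_cast card_add_one_le_pow hp.one_lt hn hS
    rw [div_le_iff₀ hpn, sub_mul, inv_mul_cancel₀ hpn.ne']
    linarith
  have hn1 : (1 : ℝ) ≤ n := mod_cast hn
  have hroot : (n : ℝ) ^ ((1 : ℝ) / 9) ≤ n := by
    simpa using Real.rpow_le_rpow_of_exponent_le hn1 (show (1 : ℝ) / 9 ≤ 1 by norm_num)
  rw [← div_le_iff₀ hpn]
  calc (S.card : ℝ) / (p : ℝ) ^ n ≤ q ^ n := (le_min hS1 hS2).trans (hq n)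
    _ = (2 : ℝ) ^ (Real.logb 2 q * n) := by
      rw [Real.rpow_mul two_pos.le, Real.rpow_logb two_pos (by norm_num) hq0, Real.rpow_natCast]
    _ ≤ _ := by
      refine Real.rpow_le_rpow_of_exponent_le one_le_two ?_
      rw [neg_mul, neg_neg]
      exact mul_le_mul_of_nonpos_left hroot hlog.le
end
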